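/- Let B = A^{coH} ⊆ A be a quantum principal bundle and Ω•(H) the maximal prolongation of a bicovariant FODC on H, with left-coinvariant forms Λ•. Then ver• := A⊗Λ•, equipped with the product (a⊗ϑ)∧(a'⊗ϑ') := aa'₀⊗(ϑ↼a'₁)∧ϑ' and the map d_v(a⊗ϑ) := a⊗dϑ + a₀⊗ϖ(π_ε(a₁))∧ϑ, is a differential calculus on A: the product is associative with unit 1⊗1, d_v is a degree-1 map with d_v∘d_v = 0 satisfying the graded Leibniz rule, and ver• is generated in degree 0 by ver⁰ = A⊗k. -/

import Mathlib

open TensorProduct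

noncomputable section

namespace NCG

variable {k : Type*} [CommRing k]

/-! ## Coactions -/

section Coactions

variable {H : Type*} [AddCommMonoid H] [Module k H] [Coalgebra k H]
variable {M : Type*} [AddCommMonoid M] [Module k M]

/-- `ρ : M → M ⊗ H` is a (counital, coassociative) right `H`-coaction. -/
def IsRightCoaction (ρ : M →ₗ[k] M ⊗[k] H) : Prop :=
  (LinearMap.lTensor M (Coalgebra.counit (R := k) (A := H)) ∘ₗ ρ
      = (TensorProduct.mk k M k).flip 1) ∧
  ((TensorProduct.assoc k M H H).toLinearMap ∘ₗ LinearMap.rTensor H ρ ∘ₗ ρ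
      = LinearMap.lTensor M (Coalgebra.comul (R := k) (A := H)) ∘ₗ ρ)

/-- `lam : M → H ⊗ M` is a left `H`-coaction. -/
def IsLeftCoaction (lam : M →ₗ[k] H ⊗[k] M) : Prop :=
  (LinearMap.rTensor M (Coalgebra.counit (R := k) (A := H)) ∘ₗ lam
      = TensorProduct.mk k k M 1) ∧
  ((TensorProduct.assoc k H H M).symm.toLinearMap ∘ₗ LinearMap.lTensor H lam ∘ₗ lam
      = LinearMap.rTensor M (Coalgebra.comul (R := k) (A := H)) ∘ₗ lam)

end Coactions

/-! ## Comodule algebras, coinvariants, Hopf–Galois extensions -/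

section ComodAlg

variable (k) in
/-- A right `H`-comodule algebra structure on `A`: an algebra morphism
`ρ : A → A ⊗ H` which is a right `H`-coaction. -/
structure ComodAlg (H : Type*) [Ring H] [Bialgebra k H]
    (A : Type*) [Ring A] [Algebra k A] where
  ρ : A →ₐ[k] A ⊗[k] H
  coaction : IsRightCoaction (k := k) ρ.toLinearMap

variable {H : Type*} [Ring H] [Bialgebra k H]
variable {A : Type*} [Ring A] [Algebra k A]

/-- The coinvariant subalgebra `B = A^{co H}` (as a submodule). -/
def ComodAlg.coinv (S : ComodAlg k H A) : Submodule k A where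
  carrier := {a | S.ρ a = a ⊗ₜ[k] (1 : H)}
  add_mem' := by
    intro a b ha hb
    simp only [Set.mem_setOf_eq] at *
    rw [map_add, ha, hb, TensorProduct.add_tmul]
  zero_mem' := by simp
  smul_mem' := by
    intro c a ha
    simp only [Set.mem_setOf_eq] at *
    rw [map_smul, ha, TensorProduct.smul_tmul']

lemma ComodAlg.one_mem_coinv (S : ComodAlg k H A) : (1 : A) ∈ S.coinv := by
  show S.ρ 1 = _
  rw [map_one, Algebra.TensorProduct.one_def]

/-- The lift `χ' : A ⊗ A → A ⊗ H`, `a ⊗ a' ↦ (a ⊗ 1) · ρ(a') = a a'₍₀₎ ⊗ a'₍₁₎`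
of the canonical Hopf–Galois map. -/
def chiAux (S : ComodAlg k H A) : A ⊗[k] A →ₗ[k] A ⊗[k] H :=
  TensorProduct.lift
    ((LinearMap.mul k (A ⊗[k] H) ∘ₗ (TensorProduct.mk k A H).flip 1).compl₂ S.ρ.toLinearMap)

/-- The relations defining the balanced tensor product `A ⊗_B A` over a
subalgebra (submodule) `B ⊆ A`. -/
def balRel (B : Submodule k A) : Submodule k (A ⊗[k] A) :=
  Submodule.span k
    {x | ∃ (a a' : A) (b : B), x = (a * (b : A)) ⊗ₜ[k] a' - a ⊗ₜ[k] ((b : A) * a')}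

/-- The balanced tensor product `A ⊗_B A`. -/
abbrev TensorOver (B : Submodule k A) : Type _ := (A ⊗[k] A) ⧸ balRel B

/-- `B = A^{co H} ⊆ A` is a Hopf–Galois extension:  the canonical map
`χ : A ⊗_B A → A ⊗ H` is bijective, i.e. its lift `χ'` is surjective with
kernel exactly the balanced relations. -/
def ComodAlg.IsHopfGalois (S : ComodAlg k H A) : Prop :=
  Function.Surjective (chiAux S) ∧ LinearMap.ker (chiAux S) = balRel S.coinv

/-- The canonical Hopf–Galois map `χ : A ⊗_B A → A ⊗ H` on the balanced
tensor product. -/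
def chiQ (S : ComodAlg k H A) (h : balRel S.coinv ≤ LinearMap.ker (chiAux S)) :
    TensorOver S.coinv →ₗ[k] A ⊗[k] H :=
  Submodule.liftQ _ (chiAux S) h

end ComodAlg

section HopfGalois

variable {H : Type*} [Ring H] [HopfAlgebra k H]
variable {A : Type*} [Ring A] [Algebra k A]

/-- A strong connection (in the sense of Theorem 3.7): a linear map
`ℓ : H → A ⊗ A` satisfying the four identities characterising faithfully
flat Hopf–Galois extensions (principal comodule algebras). -/
def IsStrongConnection (S : ComodAlg k H A) (ℓ : H →ₗ[k] A ⊗[k] A) : Prop :=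
  ℓ 1 = 1 ⊗ₜ[k] 1 ∧
  chiAux S ∘ₗ ℓ = TensorProduct.mk k A H 1 ∧
  LinearMap.mul' k A ∘ₗ ℓ =
    Algebra.linearMap k A ∘ₗ Coalgebra.counit (R := k) (A := H) ∧
  LinearMap.lTensor A S.ρ.toLinearMap ∘ₗ ℓ =
    (TensorProduct.assoc k A A H).toLinearMap ∘ₗ LinearMap.rTensor H ℓ ∘ₗ
      Coalgebra.comul (R := k) (A := H) ∧
  LinearMap.rTensor A S.ρ.toLinearMap ∘ₗ ℓ =
    LinearMap.rTensor A (TensorProduct.comm k H A).toLinearMap ∘ₗ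
      (TensorProduct.assoc k H A A).symm.toLinearMap ∘ₗ
      TensorProduct.map (HopfAlgebra.antipode (R := k)) ℓ ∘ₗ
      Coalgebra.comul (R := k) (A := H)

/-- A quantum principal bundle: a faithfully flat Hopf–Galois extension
`B = A^{co H} ⊆ A`, encoded (following Theorem 3.7 = Th. 6.19/6.20 of
Brzeziński–Wisbauer/Hajac et al.) as a Hopf–Galois extension admitting a
strong connection. -/
def ComodAlg.IsQPB (S : ComodAlg k H A) : Prop :=
  S.IsHopfGalois ∧ ∃ ℓ : H →ₗ[k] A ⊗[k] A, IsStrongConnection S ℓ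

end HopfGalois

/-! ## Differential graded algebras and differential calculi -/

section DGA

variable (k) in
/-- A differential graded algebra: an `ℕ`-graded algebra `Ω` together with a
degree `1` differential squaring to zero and satisfying the graded Leibniz
rule. -/
structure DGA (Ω : Type*) [Ring Ω] [Algebra k Ω] where
  grading : ℕ → Submodule k Ω
  gradedAlgebra : GradedAlgebra grading
  d : Ω →ₗ[k] Ω
  d_mem : ∀ n, ∀ x ∈ grading n, d x ∈ grading (n + 1)
  d_d : ∀ x, d (d x) = 0
  leibniz : ∀ n, ∀ ω ∈ grading n, ∀ η,
    d (ω * η) = d ω * η + ((-1 : k) ^ n) • (ω * d η)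

variable {Ω : Type*} [Ring Ω] [Algebra k Ω]

/-- Projection onto the degree `n` component of a graded algebra. -/
def DGA.projN (C : DGA k Ω) (n : ℕ) : Ω →ₗ[k] Ω :=
  letI := C.gradedAlgebra
  (C.grading n).subtype ∘ₗ DirectSum.component k ℕ (fun i => ↥(C.grading i)) n ∘ₗ
    (DirectSum.decomposeLinearEquiv C.grading).toLinearMap

/-- The sign operator `ς` of a graded algebra, acting by `(-1)^n` in degree `n`. -/
def DGA.sign (C : DGA k Ω) : Ω →ₗ[k] Ω :=
  letI := C.gradedAlgebra
  (DirectSum.toModule k ℕ Ω fun n => ((-1 : k) ^ n) • (C.grading n).subtype) ∘ₗ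
    (DirectSum.decomposeLinearEquiv C.grading).toLinearMap

variable {Ξ : Type*} [Ring Ξ] [Algebra k Ξ]
variable {M : Type*} [AddCommGroup M] [Module k M]

/-- The graded (Koszul) braiding `Ξ ⊗ M → M ⊗ Ξ`, `θ ⊗ m ↦ (-1)^{|θ||m|} m ⊗ θ`,
where the sign on `M` is implemented by the sign operator `s`. -/
def gradedBraid (CN : DGA k Ξ) (s : M →ₗ[k] M) : Ξ ⊗[k] M →ₗ[k] M ⊗[k] Ξ :=
  letI := CN.gradedAlgebra
  TensorProduct.lift
    ((DirectSum.toModule k ℕ (M →ₗ[k] M ⊗[k] Ξ) fun j =>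
        (LinearMap.llcomp k M M (M ⊗[k] Ξ)).flip (s ^ j) ∘ₗ
          (TensorProduct.mk k M Ξ).flip ∘ₗ (CN.grading j).subtype) ∘ₗ
      (DirectSum.decomposeLinearEquiv CN.grading).toLinearMap)

/-- The multiplication of the graded (Koszul-signed) tensor product
`(m ⊗ θ)(m' ⊗ θ') = (-1)^{|θ||m'|} m m' ⊗ θ θ'`, for a (possibly non-unital
carrier) `M` with multiplication `mulM` and sign operator `sM`, and a graded
algebra `Ξ`. -/
def koszulMulGen (mulM : M ⊗[k] M →ₗ[k] M) (mulN : Ξ ⊗[k] Ξ →ₗ[k] Ξ)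
    (CN : DGA k Ξ) (sM : M →ₗ[k] M) :
    (M ⊗[k] Ξ) ⊗[k] (M ⊗[k] Ξ) →ₗ[k] M ⊗[k] Ξ :=
  TensorProduct.map mulM mulN ∘ₗ
    (TensorProduct.assoc k (M ⊗[k] M) Ξ Ξ).toLinearMap ∘ₗ
    LinearMap.rTensor Ξ
      ((TensorProduct.assoc k M M Ξ).symm.toLinearMap ∘ₗ
        LinearMap.lTensor M (gradedBraid CN sM) ∘ₗ
        (TensorProduct.assoc k M Ξ M).toLinearMap) ∘ₗ
    (TensorProduct.assoc k (M ⊗[k] Ξ) M Ξ).symm.toLinearMap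

/-- The Koszul multiplication on the tensor product of two graded algebras. -/
def koszulMul (CM : DGA k Ω) (CN : DGA k Ξ) :
    (Ω ⊗[k] Ξ) ⊗[k] (Ω ⊗[k] Ξ) →ₗ[k] Ω ⊗[k] Ξ :=
  koszulMulGen (LinearMap.mul' k Ω) (LinearMap.mul' k Ξ) CN CM.sign

/-- The tensor product differential `d_⊗ = d ⊗ 1 + ς ⊗ d'`. -/
def dTensorGen (dM : M →ₗ[k] M) (sM : M →ₗ[k] M) {N : Type*} [AddCommGroup N]
    [Module k N] (dN : N →ₗ[k] N) : M ⊗[k] N →ₗ[k] M ⊗[k] N :=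
  TensorProduct.map dM LinearMap.id + TensorProduct.map sM dN

/-- The grading of the tensor product of two graded modules. -/
def tensorGrading {N : Type*} [AddCommGroup N] [Module k N]
    (𝒜 : ℕ → Submodule k M) (ℬ : ℕ → Submodule k N) (n : ℕ) :
    Submodule k (M ⊗[k] N) :=
  ⨆ p : {p : ℕ × ℕ // p.1 + p.2 = n},
    LinearMap.range (TensorProduct.map (𝒜 p.1.1).subtype (ℬ p.1.2).subtype)

end DGA

section DiffCalc

variable (k) in
/-- A differential calculus on an algebra `A`: a differential graded algebra
`Ω` with degree-zero part `A` (embedded via `ι`), generated in degree zero. -/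
structure DiffCalc (A : Type*) [Ring A] [Algebra k A]
    (Ω : Type*) [Ring Ω] [Algebra k Ω] extends DGA k Ω where
  ι : A →ₐ[k] Ω
  ι_injective : Function.Injective ι
  range_ι : ∀ x, x ∈ grading 0 ↔ x ∈ Set.range ι
  generated : Algebra.adjoin k (Set.range ι ∪ ⇑d '' Set.range ι) = ⊤

variable {A : Type*} [Ring A] [Algebra k A]
variable {Ω : Type*} [Ring Ω] [Algebra k Ω]

lemma DiffCalc.ι_mem (C : DiffCalc k A Ω) (a : A) : C.ι a ∈ C.grading 0 :=
  (C.range_ι _).2 ⟨a, rfl⟩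

lemma DiffCalc.d_ι_mem (C : DiffCalc k A Ω) (a : A) : C.d (C.ι a) ∈ C.grading 1 := by
  simpa using C.d_mem 0 (C.ι a) (C.ι_mem a)

lemma DiffCalc.sandwich_mem (C : DiffCalc k A Ω) (a b : A) {x : Ω}
    (hx : x ∈ C.grading 1) : C.ι a * x * C.ι b ∈ C.grading 1 := by
  letI := C.gradedAlgebra
  have h1 : C.ι a * x ∈ C.grading (0 + 1) := SetLike.mul_mem_graded (C.ι_mem a) hx
  have h2 : C.ι a * x * C.ι b ∈ C.grading (0 + 1 + 0) :=
    SetLike.mul_mem_graded h1 (C.ι_mem b)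
  simpa using h2

/-- The degree-zero identification `A ≃ Ω⁰`. -/
def DiffCalc.iota0 (C : DiffCalc k A Ω) : A ≃ₗ[k] ↥(C.grading 0) :=
  LinearEquiv.ofBijective (LinearMap.codRestrict (C.grading 0) C.ι.toLinearMap C.ι_mem)
    ⟨fun a b hab => C.ι_injective (congrArg Subtype.val hab),
     fun y => by
      obtain ⟨a, ha⟩ := (C.range_ι ↑y).1 y.2
      exact ⟨a, Subtype.ext ha⟩⟩

/-- Projection `Ω → A` onto the degree-zero component. -/
def DiffCalc.proj0 (C : DiffCalc k A Ω) : Ω →ₗ[k] A :=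
  letI := C.gradedAlgebra
  C.iota0.symm.toLinearMap ∘ₗ DirectSum.component k ℕ (fun i => ↥(C.grading i)) 0 ∘ₗ
    (DirectSum.decomposeLinearEquiv C.grading).toLinearMap

end DiffCalc

/-! ## Covariant calculi -/

section Covariant

variable {H : Type*} [Ring H] [Bialgebra k H]
variable {A : Type*} [Ring A] [Algebra k A]
variable {Ω : Type*} [Ring Ω] [Algebra k Ω]

/-- The comultiplication of a bialgebra, as a comodule-algebra structure of
`H` over itself. -/
def comulComod (k : Type*) [CommRing k] (H : Type*) [Ring H] [Bialgebra k H] :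
    ComodAlg k H H where
  ρ := Bialgebra.comulAlgHom k H
  coaction := by
    constructor
    · exact Coalgebra.lTensor_counit_comp_comul
    · exact Coalgebra.coassoc

/-- A right `H`-covariant differential calculus on a comodule algebra `A`:
the coaction `ΔR` extends `ρ` multiplicatively, degree-wise, and commutes
with the differential. -/
def IsRightCovariant (S : ComodAlg k H A) (C : DiffCalc k A Ω)
    (ΔR : Ω →ₗ[k] Ω ⊗[k] H) : Prop :=
  IsRightCoaction (k := k) ΔR ∧
  ΔR 1 = 1 ∧ (∀ x y, ΔR (x * y) = ΔR x * ΔR y) ∧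
  (∀ n, ∀ x ∈ C.grading n,
    ΔR x ∈ LinearMap.range (LinearMap.rTensor H (C.grading n).subtype)) ∧
  ΔR ∘ₗ C.d = LinearMap.rTensor H C.d ∘ₗ ΔR ∧
  ΔR ∘ₗ C.ι.toLinearMap = LinearMap.rTensor H C.ι.toLinearMap ∘ₗ S.ρ.toLinearMap

/-- A left-covariant differential calculus on the Hopf algebra `H` itself:
the left coaction `ΛL` extends the comultiplication. -/
def IsLeftCovariantH (C : DiffCalc k H Ω) (ΛL : Ω →ₗ[k] H ⊗[k] Ω) : Prop :=
  IsLeftCoaction (k := k) ΛL ∧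
  ΛL 1 = 1 ∧ (∀ x y, ΛL (x * y) = ΛL x * ΛL y) ∧
  (∀ n, ∀ x ∈ C.grading n,
    ΛL x ∈ LinearMap.range (LinearMap.lTensor H (C.grading n).subtype)) ∧
  ΛL ∘ₗ C.d = LinearMap.lTensor H C.d ∘ₗ ΛL ∧
  ΛL ∘ₗ C.ι.toLinearMap =
    LinearMap.lTensor H C.ι.toLinearMap ∘ₗ Coalgebra.comul (R := k) (A := H)

/-- A bicovariant differential calculus on `H`: commuting right and left
covariant structures both extending the comultiplication. -/
def IsBicovariantH (C : DiffCalc k H Ω) (ΔR : Ω →ₗ[k] Ω ⊗[k] H)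
    (ΛL : Ω →ₗ[k] H ⊗[k] Ω) : Prop :=
  IsRightCovariant (comulComod k H) C ΔR ∧ IsLeftCovariantH C ΛL ∧
  LinearMap.rTensor H ΛL ∘ₗ ΔR =
    (TensorProduct.assoc k H Ω H).symm.toLinearMap ∘ₗ LinearMap.lTensor H ΔR ∘ₗ ΛL

/-- Left-coinvariant elements of a left comodule. -/
def leftCoinv {M : Type*} [AddCommGroup M] [Module k M]
    (lam : M →ₗ[k] H ⊗[k] M) : Submodule k M where
  carrier := {m | lam m = 1 ⊗ₜ[k] m}
  add_mem' := by
    intro a b ha hb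
    simp only [Set.mem_setOf_eq] at *
    rw [map_add, ha, hb, TensorProduct.tmul_add]
  zero_mem' := by simp
  smul_mem' := by
    intro c m hm
    simp only [Set.mem_setOf_eq] at *
    rw [map_smul, hm, TensorProduct.tmul_smul]

end Covariant

/-! ## Maximal prolongations -/

section MaxProl

universe u

variable {A : Type*} [Ring A] [Algebra k A]
variable {Ω : Type*} [Ring Ω] [Algebra k Ω]

/-- `g` identifies the first-order parts of the differential calculi `C` and
`C'` (as first order differential calculi over `A`). -/
def Matches1 {Ω' : Type*} [Ring Ω'] [Algebra k Ω'] (C : DiffCalc k A Ω)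
    (C' : DiffCalc k A Ω') (g : ↥(C.grading 1) →ₗ[k] Ω') : Prop :=
  (∀ x : C.grading 1, g x ∈ C'.grading 1) ∧
  Function.Injective g ∧
  (∀ y ∈ C'.grading 1, ∃ x, g x = y) ∧
  (∀ a : A, g ⟨C.d (C.ι a), C.d_ι_mem a⟩ = C'.d (C'.ι a)) ∧
  (∀ (a b : A) (x : C.grading 1),
    g ⟨C.ι a * ↑x * C.ι b, C.sandwich_mem a b x.2⟩ = C'.ι a * g x * C'.ι b)

/-- `C` is the maximal prolongation of its own first-order part: any other
differential calculus on `A` with the same first order is a quotient of `C`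
(universal property of the maximal prolongation). -/
def IsMaxProl (C : DiffCalc k A Ω) : Prop :=
  ∀ (Ω' : Type u) [Ring Ω'] [Algebra k Ω'], ∀ (C' : DiffCalc k A Ω')
    (g : ↥(C.grading 1) →ₗ[k] Ω'), Matches1 C C' g →
    ∃ Φ : Ω →ₐ[k] Ω',
      (∀ n, ∀ x ∈ C.grading n, Φ x ∈ C'.grading n) ∧
      (∀ x, Φ (C.d x) = C'.d (Φ x)) ∧
      (∀ a, Φ (C.ι a) = C'.ι a) ∧
      (∀ x : C.grading 1, Φ ↑x = g x)

end MaxProl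

/-! ## Complete calculi -/

section Complete

variable {H : Type*} [Ring H] [HopfAlgebra k H]
variable {A : Type*} [Ring A] [Algebra k A]
variable {ΩA : Type*} [Ring ΩA] [Algebra k ΩA]
variable {ΩH : Type*} [Ring ΩH] [Algebra k ΩH]

/-- `D` is an extension of the coaction `ρ : A → A ⊗ H` to a morphism of
differential graded algebras `Ω(A) → Ω(A) ⊗ Ω(H)` (Koszul signs built into
the target); i.e. the calculus `Ω(A)` is *complete* with extension `D`. -/
def IsCompleteExt (S : ComodAlg k H A) (CA : DiffCalc k A ΩA)
    (CH : DiffCalc k H ΩH) (D : ΩA →ₗ[k] ΩA ⊗[k] ΩH) : Prop :=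
  D 1 = 1 ⊗ₜ[k] 1 ∧
  (∀ x y, D (x * y) = koszulMul CA.toDGA CH.toDGA (D x ⊗ₜ[k] D y)) ∧
  D ∘ₗ CA.ι.toLinearMap =
    TensorProduct.map CA.ι.toLinearMap CH.ι.toLinearMap ∘ₗ S.ρ.toLinearMap ∧
  D ∘ₗ CA.d = dTensorGen CA.d CA.toDGA.sign CH.d ∘ₗ D ∧
  (∀ n, ∀ x ∈ CA.grading n, D x ∈ tensorGrading CA.grading CH.grading n)

/-- A complete calculus on the Hopf algebra `H` itself: the comultiplication
extends to a morphism of differential graded algebras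
`Ω(H) → Ω(H) ⊗ Ω(H)`. -/
def IsCompleteExtH (CH : DiffCalc k H ΩH) (D : ΩH →ₗ[k] ΩH ⊗[k] ΩH) : Prop :=
  IsCompleteExt (comulComod k H) CH CH D

/-- The graded counit `ε•` of a complete calculus on `H`: the counit in degree
zero and zero in positive degrees. -/
def epsBul (CH : DiffCalc k H ΩH) : ΩH →ₗ[k] k :=
  Coalgebra.counit (R := k) (A := H) ∘ₗ CH.proj0

end Complete

end NCG
namespace NCG

variable {k : Type*} [CommRing k]

/-! ## First order differential calculi -/

section FODC

variable (k) in
/-- A first order differential calculus `(Γ, d)` on `A`: an `A`-bimodule `Γ`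
(with explicit structure maps) together with a derivation `d : A → Γ`
generating `Γ`. -/
structure FODC (A : Type*) [Ring A] [Algebra k A]
    (Γ : Type*) [AddCommGroup Γ] [Module k Γ] where
  lsmul : A →ₗ[k] Γ →ₗ[k] Γ
  rsmul : A →ₗ[k] Γ →ₗ[k] Γ
  one_lsmul : ∀ x, lsmul 1 x = x
  one_rsmul : ∀ x, rsmul 1 x = x
  mul_lsmul : ∀ a b x, lsmul (a * b) x = lsmul a (lsmul b x)
  mul_rsmul : ∀ a b x, rsmul (a * b) x = rsmul b (rsmul a x)
  lsmul_rsmul : ∀ a b x, lsmul a (rsmul b x) = rsmul b (lsmul a x)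
  d : A →ₗ[k] Γ
  leibniz : ∀ a b, d (a * b) = lsmul a (d b) + rsmul b (d a)
  surj : Submodule.span k {x | ∃ a b, x = lsmul a (d b)} = ⊤

end FODC

/-! ## Diagonal actions on tensor products -/

section ActionHelpers

variable {A H Γ : Type*} [Ring A] [Algebra k A] [Ring H] [Algebra k H]
variable [AddCommGroup Γ] [Module k Γ]

/-- Left action of `A ⊗ H` on `Γ ⊗ H`: `(a ⊗ h) ⊳ (x ⊗ g) = (a ⊳ x) ⊗ h g`. -/
def lactTH (act : A →ₗ[k] Γ →ₗ[k] Γ) :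
    (A ⊗[k] H) →ₗ[k] (Γ ⊗[k] H) →ₗ[k] Γ ⊗[k] H :=
  TensorProduct.curry
    (TensorProduct.map (TensorProduct.lift act) (LinearMap.mul' k H) ∘ₗ
      (TensorProduct.tensorTensorTensorComm k A H Γ H).toLinearMap)

/-- Right action of `A ⊗ H` on `Γ ⊗ H`: `(x ⊗ g) ⊲ (a ⊗ h) = (x ⊲ a) ⊗ g h`. -/
def ractTH (act : A →ₗ[k] Γ →ₗ[k] Γ) :
    (A ⊗[k] H) →ₗ[k] (Γ ⊗[k] H) →ₗ[k] Γ ⊗[k] H :=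
  TensorProduct.curry
    (TensorProduct.map (TensorProduct.lift act)
        (LinearMap.mul' k H ∘ₗ (TensorProduct.comm k H H).toLinearMap) ∘ₗ
      (TensorProduct.tensorTensorTensorComm k A H Γ H).toLinearMap)

/-- Left action of `A ⊗ H` on `A ⊗ Γ`: `(a ⊗ h) ⊳ (c ⊗ x) = a c ⊗ (h ⊳ x)`. -/
def lactHT (act : H →ₗ[k] Γ →ₗ[k] Γ) :
    (A ⊗[k] H) →ₗ[k] (A ⊗[k] Γ) →ₗ[k] A ⊗[k] Γ :=
  TensorProduct.curry
    (TensorProduct.map (LinearMap.mul' k A) (TensorProduct.lift act) ∘ₗ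
      (TensorProduct.tensorTensorTensorComm k A H A Γ).toLinearMap)

/-- Right action of `A ⊗ H` on `A ⊗ Γ`: `(c ⊗ x) ⊲ (a ⊗ h) = c a ⊗ (x ⊲ h)`. -/
def ractHT (act : H →ₗ[k] Γ →ₗ[k] Γ) :
    (A ⊗[k] H) →ₗ[k] (A ⊗[k] Γ) →ₗ[k] A ⊗[k] Γ :=
  TensorProduct.curry
    (TensorProduct.map (LinearMap.mul' k A ∘ₗ (TensorProduct.comm k A A).toLinearMap)
        (TensorProduct.lift act) ∘ₗ
      (TensorProduct.tensorTensorTensorComm k A H A Γ).toLinearMap)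

end ActionHelpers

/-! ## Covariant first order calculi and first order extensions -/

section FODCCov

variable {H : Type*} [Ring H] [Bialgebra k H]
variable {A : Type*} [Ring A] [Algebra k A]
variable {Γ : Type*} [AddCommGroup Γ] [Module k Γ]
variable {ΓH : Type*} [AddCommGroup ΓH] [Module k ΓH]

/-- Right `H`-covariance of a FODC `(Γ, d)` on a comodule algebra `A`. -/
def FODC.IsRightCovariant (S : ComodAlg k H A) (C : FODC k A Γ)
    (ΔΓ : Γ →ₗ[k] Γ ⊗[k] H) : Prop :=
  IsRightCoaction (k := k) ΔΓ ∧
  (∀ a x, ΔΓ (C.lsmul a x) = lactTH C.lsmul (S.ρ a) (ΔΓ x)) ∧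
  (∀ a x, ΔΓ (C.rsmul a x) = ractTH C.rsmul (S.ρ a) (ΔΓ x)) ∧
  ΔΓ ∘ₗ C.d = LinearMap.rTensor H C.d ∘ₗ S.ρ.toLinearMap

/-- Left covariance of a FODC `(Γ, d)` on the Hopf algebra `H` itself. -/
def FODC.IsLeftCovariantH (C : FODC k H Γ) (ΛΓ : Γ →ₗ[k] H ⊗[k] Γ) : Prop :=
  IsLeftCoaction (k := k) ΛΓ ∧
  (∀ h x, ΛΓ (C.lsmul h x) =
    lactHT C.lsmul (Coalgebra.comul (R := k) (A := H) h) (ΛΓ x)) ∧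
  (∀ h x, ΛΓ (C.rsmul h x) =
    ractHT C.rsmul (Coalgebra.comul (R := k) (A := H) h) (ΛΓ x)) ∧
  ΛΓ ∘ₗ C.d = LinearMap.lTensor H C.d ∘ₗ Coalgebra.comul (R := k) (A := H)

/-- Bicovariance of a FODC on `H`: commuting right and left covariant
structures. -/
def FODC.IsBicovariantH (C : FODC k H Γ) (ΔΓ : Γ →ₗ[k] Γ ⊗[k] H)
    (ΛΓ : Γ →ₗ[k] H ⊗[k] Γ) : Prop :=
  FODC.IsRightCovariant (comulComod k H) C ΔΓ ∧ FODC.IsLeftCovariantH C ΛΓ ∧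
  LinearMap.rTensor H ΛΓ ∘ₗ ΔΓ =
    (TensorProduct.assoc k H Γ H).symm.toLinearMap ∘ₗ LinearMap.lTensor H ΔΓ ∘ₗ ΛΓ

/-- `D` is an extension of the coaction `ρ : A → A ⊗ H` to a morphism of first
order differential calculi `Γ_A → Ω¹(A ⊗ H) = (Γ_A ⊗ H) ⊕ (A ⊗ Γ_H)`, i.e.
a map covering `ρ`, `ρ`-bilinear and intertwining `d` with `d_⊗`. -/
def IsFirstOrderExt (S : ComodAlg k H A) (CA : FODC k A Γ) (CHf : FODC k H ΓH)
    (D : Γ →ₗ[k] (Γ ⊗[k] H) × (A ⊗[k] ΓH)) : Prop :=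
  (∀ a x, D (CA.lsmul a x) =
    (lactTH CA.lsmul (S.ρ a) (D x).1, lactHT CHf.lsmul (S.ρ a) (D x).2)) ∧
  (∀ a x, D (CA.rsmul a x) =
    (ractTH CA.rsmul (S.ρ a) (D x).1, ractHT CHf.rsmul (S.ρ a) (D x).2)) ∧
  D ∘ₗ CA.d =
    (LinearMap.rTensor H CA.d ∘ₗ S.ρ.toLinearMap).prod
      (LinearMap.lTensor A CHf.d ∘ₗ S.ρ.toLinearMap)

end FODCCov

/-! ## Vertical forms -/

section Vertical

variable {H : Type*} [Ring H] [HopfAlgebra k H]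
variable {A : Type*} [Ring A] [Algebra k A]
variable {ΩH : Type*} [Ring ΩH] [Algebra k ΩH]

/-- Two-sided multiplication `Ω ⊗ Ω →ₗ (Ω →ₗ Ω)`, `(x ⊗ z) ↦ (y ↦ x y z)`. -/
def bimul (Ω : Type*) [Ring Ω] [Algebra k Ω] : Ω ⊗[k] Ω →ₗ[k] Ω →ₗ[k] Ω :=
  TensorProduct.lift
    ((LinearMap.llcomp k Ω Ω Ω ∘ₗ LinearMap.mul k Ω).compl₂ (LinearMap.mul k Ω).flip)

/-- The right adjoint action `ω ↼ h = S(h₁) ω h₂` of `H` on forms `Ω(H)`. -/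
def adAct (CH : DiffCalc k H ΩH) : H →ₗ[k] ΩH →ₗ[k] ΩH :=
  bimul ΩH ∘ₗ
    TensorProduct.map (CH.ι.toLinearMap ∘ₗ HopfAlgebra.antipode (R := k))
      CH.ι.toLinearMap ∘ₗ
    Coalgebra.comul (R := k) (A := H)

/-- The Cartan–Maurer map `h ↦ ϖ(π_ε(h)) = S(h₁) d(h₂)`. -/
def cartan (CH : DiffCalc k H ΩH) : H →ₗ[k] ΩH :=
  LinearMap.mul' k ΩH ∘ₗ
    TensorProduct.map (CH.ι.toLinearMap ∘ₗ HopfAlgebra.antipode (R := k))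
      (CH.d ∘ₗ CH.ι.toLinearMap) ∘ₗ
    Coalgebra.comul (R := k) (A := H)

/-- The projection `π_Λ : ω ↦ S(ω₋₁) ω₀` onto left-coinvariant forms. -/
def piLam (CH : DiffCalc k H ΩH) (ΛL : ΩH →ₗ[k] H ⊗[k] ΩH) : ΩH →ₗ[k] ΩH :=
  LinearMap.mul' k ΩH ∘ₗ
    TensorProduct.map (CH.ι.toLinearMap ∘ₗ HopfAlgebra.antipode (R := k))
      LinearMap.id ∘ₗ ΛL

/-- The multiplication `(a ⊗ ϑ) ∧ (a' ⊗ ϑ') = a a'₍₀₎ ⊗ (ϑ ↼ a'₍₁₎) ∧ ϑ'` of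
vertical forms, as a map on the ambient space `A ⊗ Ω(H)`. -/
def verMul (S : ComodAlg k H A) (CH : DiffCalc k H ΩH) :
    (A ⊗[k] ΩH) ⊗[k] (A ⊗[k] ΩH) →ₗ[k] A ⊗[k] ΩH :=
  TensorProduct.map (LinearMap.mul' k A)
      (LinearMap.mul' k ΩH ∘ₗ
        LinearMap.rTensor ΩH (TensorProduct.lift (adAct CH).flip) ∘ₗ
        (TensorProduct.assoc k ΩH H ΩH).symm.toLinearMap) ∘ₗ
    (TensorProduct.tensorTensorTensorComm k A ΩH A (H ⊗[k] ΩH)).toLinearMap ∘ₗ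
    LinearMap.lTensor (A ⊗[k] ΩH)
      ((TensorProduct.assoc k A H ΩH).toLinearMap ∘ₗ
        LinearMap.rTensor ΩH S.ρ.toLinearMap)

/-- The vertical differential
`d_v(a ⊗ ϑ) = a ⊗ dϑ + a₍₀₎ ⊗ ϖ(π_ε(a₍₁₎)) ∧ ϑ`. -/
def verD (S : ComodAlg k H A) (CH : DiffCalc k H ΩH) :
    A ⊗[k] ΩH →ₗ[k] A ⊗[k] ΩH :=
  LinearMap.lTensor A CH.d +
    LinearMap.lTensor A
        (LinearMap.mul' k ΩH ∘ₗ LinearMap.rTensor ΩH (cartan CH)) ∘ₗ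
      (TensorProduct.assoc k A H ΩH).toLinearMap ∘ₗ
      LinearMap.rTensor ΩH S.ρ.toLinearMap

/-- The vertical forms `ver• = A ⊗ Λ•` as a submodule of `A ⊗ Ω(H)`. -/
def verSub (A : Type*) [Ring A] [Algebra k A] (ΛL : ΩH →ₗ[k] H ⊗[k] ΩH) :
    Submodule k (A ⊗[k] ΩH) :=
  LinearMap.range (LinearMap.lTensor A (leftCoinv ΛL).subtype)

/-- The degree-`n` vertical forms `ver^n = A ⊗ Λⁿ`. -/
def verSubN (A : Type*) [Ring A] [Algebra k A] (CH : DiffCalc k H ΩH)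
    (ΛL : ΩH →ₗ[k] H ⊗[k] ΩH) (n : ℕ) : Submodule k (A ⊗[k] ΩH) :=
  LinearMap.range (LinearMap.lTensor A ((leftCoinv ΛL ⊓ CH.grading n)).subtype)

end Vertical

/-! ## Quotient multiplications on balanced tensor products -/

section QuotMul

variable {A : Type*} [Ring A] [Algebra k A]

/-- Left multiplication (by `x`) on the first leg of `A ⊗ A`, followed by the
projection onto `A ⊗_B A`. -/
def lmulQaux (B : Submodule k A) (x : A) :
    A ⊗[k] A →ₗ[k] TensorOver (k := k) B :=
  (balRel B).mkQ ∘ₗ LinearMap.rTensor A (LinearMap.mul k A x)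

lemma lmulQaux_rel (B : Submodule k A) (x : A) :
    balRel (k := k) B ≤ LinearMap.ker (lmulQaux B x) := by
  refine Submodule.span_le.mpr ?_
  rintro z ⟨a, a', b, rfl⟩
  simp only [SetLike.mem_coe, LinearMap.mem_ker, lmulQaux, LinearMap.coe_comp,
    Function.comp_apply, map_sub, LinearMap.rTensor_tmul, LinearMap.mul_apply']
  rw [← map_sub, Submodule.mkQ_apply, Submodule.Quotient.mk_eq_zero]
  apply Submodule.subset_span
  exact ⟨x * a, a', b, by rw [mul_assoc]⟩

/-- Left multiplication on the first leg of `A ⊗_B A`. -/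
def lmulQ (B : Submodule k A) :
    A →ₗ[k] TensorOver (k := k) B →ₗ[k] TensorOver (k := k) B where
  toFun x := Submodule.liftQ _ (lmulQaux B x) (lmulQaux_rel B x)
  map_add' x y := by
    apply Submodule.linearMap_qext
    simp only [Submodule.liftQ_mkQ, LinearMap.add_comp, Submodule.liftQ_mkQ]
    simp only [lmulQaux, map_add, LinearMap.rTensor_add, LinearMap.comp_add]
  map_smul' c x := by
    apply Submodule.linearMap_qext
    simp only [RingHom.id_apply, Submodule.liftQ_mkQ, LinearMap.smul_comp,
      Submodule.liftQ_mkQ]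
    simp only [lmulQaux, map_smul, LinearMap.rTensor_smul, LinearMap.comp_smul]

/-- Right multiplication (by `x`) on the second leg of `A ⊗ A`, followed by
the projection onto `A ⊗_B A`. -/
def rmulQaux (B : Submodule k A) (x : A) :
    A ⊗[k] A →ₗ[k] TensorOver (k := k) B :=
  (balRel B).mkQ ∘ₗ LinearMap.lTensor A ((LinearMap.mul k A).flip x)

lemma rmulQaux_rel (B : Submodule k A) (x : A) :
    balRel (k := k) B ≤ LinearMap.ker (rmulQaux B x) := by
  refine Submodule.span_le.mpr ?_
  rintro z ⟨a, a', b, rfl⟩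
  simp only [SetLike.mem_coe, LinearMap.mem_ker, rmulQaux, LinearMap.coe_comp,
    Function.comp_apply, map_sub, LinearMap.lTensor_tmul, LinearMap.flip_apply,
    LinearMap.mul_apply']
  rw [← map_sub, Submodule.mkQ_apply, Submodule.Quotient.mk_eq_zero]
  apply Submodule.subset_span
  exact ⟨a, a' * x, b, by rw [mul_assoc]⟩

/-- Right multiplication on the second leg of `A ⊗_B A`. -/
def rmulQ (B : Submodule k A) :
    A →ₗ[k] TensorOver (k := k) B →ₗ[k] TensorOver (k := k) B where
  toFun x := Submodule.liftQ _ (rmulQaux B x) (rmulQaux_rel B x)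
  map_add' x y := by
    apply Submodule.linearMap_qext
    simp only [Submodule.liftQ_mkQ, LinearMap.add_comp, Submodule.liftQ_mkQ]
    simp only [rmulQaux, map_add, LinearMap.lTensor_add, LinearMap.comp_add]
  map_smul' c x := by
    apply Submodule.linearMap_qext
    simp only [RingHom.id_apply, Submodule.liftQ_mkQ, LinearMap.smul_comp,
      Submodule.liftQ_mkQ]
    simp only [rmulQaux, map_smul, LinearMap.lTensor_smul, LinearMap.comp_smul]

end QuotMul

/-! ## Base, horizontal and balanced graded forms -/

section GradedHG

variable {H : Type*} [Ring H] [HopfAlgebra k H]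
variable {A : Type*} [Ring A] [Algebra k A]
variable {ΩA : Type*} [Ring ΩA] [Algebra k ΩA]
variable {ΩH : Type*} [Ring ΩH] [Algebra k ΩH]

/-- The base forms `Ω•(B)`: forms invariant under the extended coaction. -/
def baseForms (D : ΩA →ₗ[k] ΩA ⊗[k] ΩH) : Submodule k ΩA where
  carrier := {ω | D ω = ω ⊗ₜ[k] 1}
  add_mem' := by
    intro a b ha hb
    simp only [Set.mem_setOf_eq] at *
    rw [map_add, ha, hb, TensorProduct.add_tmul]
  zero_mem' := by simp
  smul_mem' := by
    intro c a ha
    simp only [Set.mem_setOf_eq] at *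
    rw [map_smul, ha, TensorProduct.smul_tmul']

/-- The horizontal forms `hor• = (Δ_A•)⁻¹(Ω•(A) ⊗ H)`. -/
def horForms (CH : DiffCalc k H ΩH) (D : ΩA →ₗ[k] ΩA ⊗[k] ΩH) : Submodule k ΩA :=
  Submodule.comap D (LinearMap.range (LinearMap.lTensor ΩA CH.ι.toLinearMap))

/-- The lift `Ω(A) ⊗ Ω(A) → Ω(A) ⊗ Ω(H)`, `ω ⊗ η ↦ (ω ∧ η₍₀₎) ⊗ η₍₁₎` of the
graded canonical Hopf–Galois map. -/
def chiBulAux (D : ΩA →ₗ[k] ΩA ⊗[k] ΩH) : ΩA ⊗[k] ΩA →ₗ[k] ΩA ⊗[k] ΩH :=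
  LinearMap.rTensor ΩH (LinearMap.mul' k ΩA) ∘ₗ
    (TensorProduct.assoc k ΩA ΩA ΩH).symm.toLinearMap ∘ₗ LinearMap.lTensor ΩA D

end GradedHG

end NCG
namespace NCG

variable {k : Type*} [CommRing k]

section YDHelpers

variable {H : Type*} [Ring H] [HopfAlgebra k H]
variable {ΩH : Type*} [Ring ΩH] [Algebra k ΩH]

/-- `h ↦ h₂ ⊗ (h₁ ⊗ h₃)`. -/
def comul13 : H →ₗ[k] H ⊗[k] (H ⊗[k] H) :=
  (TensorProduct.assoc k H H H).toLinearMap ∘ₗ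
    LinearMap.rTensor H (TensorProduct.comm k H H).toLinearMap ∘ₗ
    (TensorProduct.assoc k H H H).symm.toLinearMap ∘ₗ
    LinearMap.lTensor H (Coalgebra.comul (R := k) (A := H)) ∘ₗ
    Coalgebra.comul (R := k) (A := H)

/-- The sandwich action `(g ⊗ g') ↦ (ω ↦ ι(S(g)) ω ι(g'))`. -/
def sandwich (CH : DiffCalc k H ΩH) : H ⊗[k] H →ₗ[k] ΩH →ₗ[k] ΩH :=
  bimul ΩH ∘ₗ
    TensorProduct.map (CH.ι.toLinearMap ∘ₗ HopfAlgebra.antipode (R := k))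
      CH.ι.toLinearMap

/-- The right hand side `(ϑ₍₁₎ ↼ h₂) ⊗ S(h₁) ϑ₍₂₎ h₃` of the Yetter–Drinfel'd
compatibility condition, evaluated on `t = ϑ₍₁₎ ⊗ ϑ₍₂₎`. -/
def ydRHS (CH : DiffCalc k H ΩH) (h : H) (t : ΩH ⊗[k] ΩH) : ΩH ⊗[k] ΩH :=
  (TensorProduct.map (TensorProduct.lift (adAct CH))
      (TensorProduct.lift (sandwich CH)) ∘ₗ
    (TensorProduct.tensorTensorTensorComm k H (H ⊗[k] H) ΩH ΩH).toLinearMap)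
    (comul13 (k := k) h ⊗ₜ[k] t)

/-- The canonical extension `Δ•_bc` of the comultiplication to a bicovariant
calculus: `Δ` on degree `0` and `Δ_R + _ΩΔ` in positive degrees. -/
def deltaBc (CH : DiffCalc k H ΩH) (ΔR : ΩH →ₗ[k] ΩH ⊗[k] H)
    (ΛL : ΩH →ₗ[k] H ⊗[k] ΩH) : ΩH →ₗ[k] ΩH ⊗[k] ΩH :=
  TensorProduct.map CH.ι.toLinearMap CH.ι.toLinearMap ∘ₗ
      Coalgebra.comul (R := k) (A := H) ∘ₗ CH.proj0 +
    (TensorProduct.map LinearMap.id CH.ι.toLinearMap ∘ₗ ΔR +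
        TensorProduct.map CH.ι.toLinearMap LinearMap.id ∘ₗ ΛL) ∘ₗ
      (LinearMap.id - CH.ι.toLinearMap ∘ₗ CH.proj0)

/-- The map `Ξ : ω ↦ ω₋₂ ⊗ S(ω₋₁) ω₀` from `Ω•(H)` to `H ⊗ Λ•`. -/
def XiMap (CH : DiffCalc k H ΩH) (ΛL : ΩH →ₗ[k] H ⊗[k] ΩH) :
    ΩH →ₗ[k] H ⊗[k] ΩH :=
  LinearMap.lTensor H (piLam CH ΛL) ∘ₗ ΛL

/-- The multiplication map `μ : h ⊗ ϑ ↦ ι(h) ϑ`. -/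
def muMap (CH : DiffCalc k H ΩH) : H ⊗[k] ΩH →ₗ[k] ΩH :=
  LinearMap.mul' k ΩH ∘ₗ TensorProduct.map CH.ι.toLinearMap LinearMap.id

end YDHelpers

end NCG
namespace NCG

section ConvolutionCalculus

open Coalgebra WithConv

variable {k : Type*} [CommRing k]
variable {H : Type*} [Ring H] [HopfAlgebra k H]
variable {R : Type*} [Ring R] [Algebra k R]

/-- The convolution-algebra element `h ↦ ε(h) x` attached to `x`. -/
def convConst (k H : Type*) [CommRing k] [Ring H] [HopfAlgebra k H]
    {R : Type*} [Ring R] [Algebra k R] (x : R) : WithConv (H →ₗ[k] R) :=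
  toConv (LinearMap.toSpanSingleton k R x ∘ₗ counit)

lemma convConst_apply (x : R) (h : H) :
    (convConst k H x) h = counit (R := k) h • x := rfl

lemma convConst_mul_apply (x : R) (f : WithConv (H →ₗ[k] R)) (h : H) :
    (convConst k H x * f) h = x * f h := by
  rw [(ℛ k h).convMul_apply]
  simp only [convConst_apply, smul_mul_assoc]
  simp only [← mul_smul_comm, ← Finset.mul_sum, ← map_smul, ← map_sum, sum_counit_smul]

lemma convConst_mul (x y : R) :
    convConst k H (x * y) = convConst k H x * convConst k H y := by
  ext h
  change (convConst k H (x * y)) h = (convConst k H x * convConst k H y) h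
  rw [convConst_mul_apply, convConst_apply, convConst_apply, mul_smul_comm]

lemma convConst_one : convConst k H (1 : R) = 1 := by
  ext h
  exact (Algebra.algebraMap_eq_smul_one _).symm

/-- Postcomposition by a linear map on convolution algebras. -/
def convPost {R' : Type*} [Ring R'] [Algebra k R'] (g : R →ₗ[k] R') :
    WithConv (H →ₗ[k] R) →ₗ[k] WithConv (H →ₗ[k] R') where
  toFun f := toConv (g ∘ₗ f.ofConv)
  map_add' f f' := by ext; simp
  map_smul' c f := by ext; simp

lemma convPost_apply {R' : Type*} [Ring R'] [Algebra k R'] (g : R →ₗ[k] R')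
    (f : WithConv (H →ₗ[k] R)) (h : H) : (convPost g f) h = g (f h) := rfl

lemma convPost_convConst {R' : Type*} [Ring R'] [Algebra k R'] (g : R →ₗ[k] R') (x : R) :
    convPost g (convConst k H x) = convConst k H (g x) := by
  ext h
  exact map_smul g _ x

lemma convPost_algHom_mul {R' : Type*} [Ring R'] [Algebra k R'] (g : R →ₐ[k] R')
    (f f' : WithConv (H →ₗ[k] R)) :
    convPost g.toLinearMap (f * f') = convPost g.toLinearMap f * convPost g.toLinearMap f' :=
  WithConv.ext (LinearMap.algHom_comp_convMul_distrib g f f')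

lemma convPost_algHom_one {R' : Type*} [Ring R'] [Algebra k R'] (g : R →ₐ[k] R') :
    convPost g.toLinearMap (1 : WithConv (H →ₗ[k] R)) = 1 := by
  rw [← convConst_one, convPost_convConst, ← convConst_one]
  simp

variable {Ω : Type*} [Ring Ω] [Algebra k Ω]

lemma DGA.map_one_eq_zero (C : DGA k Ω) : C.d 1 = 0 := by
  let := C.gradedAlgebra
  have h := C.leibniz 0 1 (SetLike.GradedOne.one_mem) 1
  simpa using h

lemma DGA.convPost_d_one (C : DGA k Ω) :
    convPost C.d (1 : WithConv (H →ₗ[k] Ω)) = 0 := by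
  rw [← convConst_one, convPost_convConst, C.map_one_eq_zero]
  ext h
  exact smul_zero _

/-- The graded Leibniz rule for the convolution product. -/
lemma DGA.convPost_d_mul (C : DGA k Ω) {n : ℕ} {f : WithConv (H →ₗ[k] Ω)}
    (hf : ∀ h, f h ∈ C.grading n) (g : WithConv (H →ₗ[k] Ω)) :
    convPost C.d (f * g) = convPost C.d f * g + ((-1 : k) ^ n) • (f * convPost C.d g) := by
  ext h
  change C.d ((f * g) h) = (convPost C.d f * g) h + ((-1 : k) ^ n) • (f * convPost C.d g) h
  simp only [(ℛ k h).convMul_apply, map_sum, convPost_apply, Finset.smul_sum,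
    ← Finset.sum_add_distrib]
  exact Finset.sum_congr rfl fun i _ => C.leibniz n _ (hf _) _

lemma DGA.convMul_mem (C : DGA k Ω) {m n p : ℕ} (hp : m + n = p)
    {f g : WithConv (H →ₗ[k] Ω)} (hf : ∀ h, f h ∈ C.grading m)
    (hg : ∀ h, g h ∈ C.grading n) (h : H) : (f * g) h ∈ C.grading p := by
  let := C.gradedAlgebra
  subst hp
  rw [(ℛ k h).convMul_apply]
  exact Submodule.sum_mem _ fun i _ => SetLike.mul_mem_graded (hf _) (hg _)

lemma DGA.convConst_mem (C : DGA k Ω) {n : ℕ} {x : Ω} (hx : x ∈ C.grading n) (h : H) :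
    (convConst k H x) h ∈ C.grading n :=
  Submodule.smul_mem _ _ hx

variable (C : DiffCalc k H Ω)

/-- The embedding `H → Ω`, in the convolution algebra. -/
def convIota : WithConv (H →ₗ[k] Ω) := toConv C.ι.toLinearMap

/-- The convolution inverse `h ↦ S(h)` of the embedding `H → Ω`. -/
def convAntipode : WithConv (H →ₗ[k] Ω) :=
  toConv (C.ι.toLinearMap ∘ₗ HopfAlgebra.antipode (R := k))

lemma convAntipode_mul_convIota : convAntipode C * convIota C = 1 := by
  have := congrArg (convPost C.ι.toLinearMap) (LinearMap.antipode_mul_id (R := k) (C := H))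
  rwa [convPost_algHom_mul, convPost_algHom_one] at this

lemma convIota_mul_convAntipode : convIota C * convAntipode C = 1 := by
  have := congrArg (convPost C.ι.toLinearMap) (LinearMap.id_mul_antipode (R := k) (C := H))
  rwa [convPost_algHom_mul, convPost_algHom_one] at this

/-- `h ↦ ϑ ↼ h` in the convolution algebra. -/
def convAd (x : Ω) : WithConv (H →ₗ[k] Ω) := convAntipode C * convConst k H x * convIota C

/-- The Cartan–Maurer map in the convolution algebra. -/
def convCartan : WithConv (H →ₗ[k] Ω) := convAntipode C * convPost C.d (convIota C)

lemma cartan_eq_convCartan (h : H) : cartan C h = (convCartan C) h := rfl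

lemma cartan_eq_sum (h : H) :
    cartan C h = ∑ i ∈ (ℛ k h).index,
      C.ι (HopfAlgebra.antipode k ((ℛ k h).left i)) * C.d (C.ι ((ℛ k h).right i)) := by
  rw [cartan_eq_convCartan, convCartan, (ℛ k h).convMul_apply]
  rfl

lemma adAct_eq_sum (h : H) (x : Ω) :
    adAct C h x = ∑ i ∈ (ℛ k h).index,
      C.ι (HopfAlgebra.antipode k ((ℛ k h).left i)) * (x * C.ι ((ℛ k h).right i)) := by
  simp only [adAct, LinearMap.comp_apply]
  rw [← (ℛ k h).eq]
  simp [bimul]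

lemma adAct_eq_convAd (h : H) (x : Ω) : adAct C h x = (convAd C x) h := by
  rw [adAct_eq_sum, convAd, mul_assoc, (ℛ k h).convMul_apply]
  simp only [convConst_mul_apply]
  rfl

lemma convAd_mul (x y : Ω) : convAd C (x * y) = convAd C x * convAd C y := by
  have h := convIota_mul_convAntipode C
  calc convAd C (x * y)
      = convAntipode C * convConst k H x * 1 * convConst k H y * convIota C := by
        simp only [convAd, convConst_mul, mul_assoc, one_mul]
    _ = _ := by rw [← h]; simp only [convAd, mul_assoc]

lemma convAd_one : convAd C 1 = 1 := by
  rw [convAd, convConst_one, mul_one, convAntipode_mul_convIota]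

lemma convIota_mem (h : H) : (convIota C) h ∈ C.grading 0 := C.ι_mem h

lemma convAntipode_mem (h : H) : (convAntipode C) h ∈ C.grading 0 := C.ι_mem _

lemma convCartan_mem (h : H) : (convCartan C) h ∈ C.grading 1 :=
  C.convMul_mem (zero_add 1) (convAntipode_mem C) (fun h => C.d_ι_mem h) h

lemma convAd_mem {n : ℕ} {x : Ω} (hx : x ∈ C.grading n) (h : H) :
    (convAd C x) h ∈ C.grading n :=
  C.convMul_mem (add_zero n)
    (C.convMul_mem (zero_add n) (convAntipode_mem C) (C.convConst_mem hx)) (convIota_mem C) h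

lemma convPost_d_convAntipode :
    convPost C.d (convAntipode C) = -(convCartan C * convAntipode C) := by
  have h := C.convPost_d_mul (convAntipode_mem C) (convIota C)
  rw [convAntipode_mul_convIota, C.convPost_d_one, pow_zero, one_smul] at h
  have h2 := eq_neg_of_add_eq_zero_left h.symm
  calc convPost C.d (convAntipode C)
      = convPost C.d (convAntipode C) * convIota C * convAntipode C := by
        rw [mul_assoc, convIota_mul_convAntipode, mul_one]
    _ = _ := by rw [h2, neg_mul, convCartan]

/-- The Maurer–Cartan equation `dϖ(h) = -ϖ(h₁) ϖ(h₂)`. -/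
lemma convPost_d_convCartan :
    convPost C.d (convCartan C) = -(convCartan C * convCartan C) := by
  have hd : convPost C.d (convPost C.d (convIota C)) = 0 := by
    ext h
    exact C.d_d _
  conv_lhs => rw [convCartan, C.convPost_d_mul (convAntipode_mem C), hd, mul_zero, smul_zero,
    add_zero, convPost_d_convAntipode]
  rw [neg_mul, mul_assoc, ← convCartan]

lemma convPost_d_convAd {n : ℕ} {x : Ω} (hx : x ∈ C.grading n) :
    convPost C.d (convAd C x) + convCartan C * convAd C x =
      convAd C (C.d x) + ((-1 : k) ^ n) • (convAd C x * convCartan C) := by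
  have h1 : ∀ h : H, (convAntipode C * convConst k H x) h ∈ C.grading n :=
    C.convMul_mem (zero_add n) (convAntipode_mem C) (C.convConst_mem hx)
  have h2 : convAntipode C * convConst k H x * convPost C.d (convIota C)
      = convAd C x * convCartan C := by
    rw [convAd, convCartan, ← mul_assoc, mul_assoc _ (convIota C),
      convIota_mul_convAntipode, mul_one]
  conv_lhs => enter [1]; rw [convAd, C.convPost_d_mul h1, C.convPost_d_mul (convAntipode_mem C),
    convPost_convConst, convPost_d_convAntipode, h2]
  simp only [convAd, pow_zero, one_smul, add_mul, neg_mul, mul_assoc]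
  abel

lemma adAct_one (x : Ω) : adAct C 1 x = x := by
  simp [adAct, bimul, Algebra.TensorProduct.one_def]

lemma adAct_mul (g h : H) (x : Ω) : adAct C (g * h) x = adAct C h (adAct C g x) := by
  simp only [adAct, LinearMap.comp_apply, Bialgebra.comul_mul]
  rw [← (ℛ k g).eq, ← (ℛ k h).eq]
  simp only [Finset.sum_mul_sum, map_sum, Algebra.TensorProduct.tmul_mul_tmul, LinearMap.sum_apply]
  simp [bimul, HopfAlgebra.antipode_mul_antidistrib, mul_assoc]

lemma cartan_mul (g h : H) :
    cartan C (g * h) = adAct C h (cartan C g) + counit (R := k) g • cartan C h := by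
  have key : ∑ i ∈ (ℛ k g).index,
      C.ι (HopfAlgebra.antipode k ((ℛ k g).left i)) * C.ι ((ℛ k g).right i)
      = counit (R := k) g • (1 : Ω) := by
    simp only [← map_mul, ← map_sum, HopfAlgebra.sum_antipode_mul_eq_smul, map_smul, map_one]
  have hL : ∀ a b, C.d (C.ι (a * b)) = C.d (C.ι a) * C.ι b + C.ι a * C.d (C.ι b) := by
    intro a b
    rw [map_mul, C.leibniz 0 _ (C.ι_mem a), pow_zero, one_smul]
  have h1 : cartan C (g * h) = ∑ j ∈ (ℛ k h).index, ∑ i ∈ (ℛ k g).index,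
      C.ι (HopfAlgebra.antipode k ((ℛ k h).left j)) *
      (C.ι (HopfAlgebra.antipode k ((ℛ k g).left i)) *
        C.d (C.ι ((ℛ k g).right i * (ℛ k h).right j))) := by
    simp only [cartan, LinearMap.comp_apply, Bialgebra.comul_mul]
    conv_lhs => rw [← (ℛ k g).eq, ← (ℛ k h).eq]
    simp only [Finset.sum_mul_sum, map_sum, Algebra.TensorProduct.tmul_mul_tmul]
    rw [Finset.sum_comm]
    simp [HopfAlgebra.antipode_mul_antidistrib, mul_assoc]
  rw [h1, adAct_eq_sum, cartan_eq_sum C g, cartan_eq_sum C h, Finset.smul_sum,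
    ← Finset.sum_add_distrib]
  refine Finset.sum_congr rfl fun j _ => ?_
  rw [← Finset.mul_sum, ← mul_smul_comm, ← mul_add]
  congr 1
  simp only [hL, mul_add, Finset.sum_add_distrib, Finset.sum_mul, ← mul_assoc]
  simp only [← Finset.sum_mul, key, smul_mul_assoc, one_mul]

lemma d_iota_eq_sum (h : H) :
    C.d (C.ι h) = ∑ i ∈ (ℛ k h).index,
      C.ι ((ℛ k h).left i) * cartan C ((ℛ k h).right i) := by
  have h1 : convPost C.d (convIota C) = convIota C * convCartan C := by
    rw [convCartan, ← mul_assoc, convIota_mul_convAntipode, one_mul]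
  change (convPost C.d (convIota C)) h = _
  rw [h1, (ℛ k h).convMul_apply]
  rfl

lemma mul_iota_eq_sum (x : Ω) (h : H) :
    x * C.ι h = ∑ i ∈ (ℛ k h).index,
      C.ι ((ℛ k h).left i) * adAct C ((ℛ k h).right i) x := by
  have h1 : convConst k H x * convIota C = convIota C * convAd C x := by
    rw [convAd, mul_assoc, ← mul_assoc (convIota C), convIota_mul_convAntipode, one_mul]
  have h2 : (convConst k H x * convIota C) h = x * C.ι h := convConst_mul_apply _ _ _
  rw [← h2, h1, (ℛ k h).convMul_apply]
  simp only [adAct_eq_convAd]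
  rfl

end ConvolutionCalculus

section LeftCoinvariants

open Coalgebra WithConv

variable {k : Type*} [CommRing k]
variable {H : Type*} [Ring H] [HopfAlgebra k H]
variable {Ω : Type*} [Ring Ω] [Algebra k Ω]
variable {C : DiffCalc k H Ω} {ΛL : Ω →ₗ[k] H ⊗[k] Ω}

lemma mem_leftCoinv {x : Ω} : x ∈ leftCoinv ΛL ↔ ΛL x = 1 ⊗ₜ[k] x := Iff.rfl

/-- A left covariant structure on a calculus, as an algebra morphism. -/
def IsLeftCovariantH.algHom (hL : IsLeftCovariantH C ΛL) : Ω →ₐ[k] H ⊗[k] Ω :=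
  AlgHom.ofLinearMap ΛL hL.2.1 hL.2.2.1

lemma IsLeftCovariantH.algHom_toLinearMap (hL : IsLeftCovariantH C ΛL) :
    hL.algHom.toLinearMap = ΛL := rfl

lemma IsLeftCovariantH.map_d (hL : IsLeftCovariantH C ΛL) (x : Ω) :
    ΛL (C.d x) = LinearMap.lTensor H C.d (ΛL x) :=
  LinearMap.congr_fun hL.2.2.2.2.1 x

lemma IsLeftCovariantH.map_iota (hL : IsLeftCovariantH C ΛL) (h : H) :
    ΛL (C.ι h) = LinearMap.lTensor H C.ι.toLinearMap (comul h) :=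
  LinearMap.congr_fun hL.2.2.2.2.2 h

lemma IsLeftCovariantH.one_mem (hL : IsLeftCovariantH C ΛL) : 1 ∈ leftCoinv ΛL :=
  hL.2.1

lemma IsLeftCovariantH.mul_mem (hL : IsLeftCovariantH C ΛL) {x y : Ω}
    (hx : x ∈ leftCoinv ΛL) (hy : y ∈ leftCoinv ΛL) : x * y ∈ leftCoinv ΛL := by
  rw [mem_leftCoinv] at *
  rw [hL.2.2.1, hx, hy, Algebra.TensorProduct.tmul_mul_tmul, one_mul]

lemma IsLeftCovariantH.d_mem (hL : IsLeftCovariantH C ΛL) {x : Ω}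
    (hx : x ∈ leftCoinv ΛL) : C.d x ∈ leftCoinv ΛL := by
  rw [mem_leftCoinv] at *
  rw [hL.map_d, hx, LinearMap.lTensor_tmul]

/-- The convolution-algebra element `h ↦ h ⊗ 1`. -/
def convLeft (k H Ω : Type*) [CommRing k] [Ring H] [HopfAlgebra k H] [Ring Ω] [Algebra k Ω] :
    WithConv (H →ₗ[k] H ⊗[k] Ω) :=
  convPost (Algebra.TensorProduct.includeLeft : H →ₐ[k] H ⊗[k] Ω).toLinearMap
    (toConv LinearMap.id)

/-- The convolution-algebra element `h ↦ S(h) ⊗ 1`. -/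
def convLeftInv (k H Ω : Type*) [CommRing k] [Ring H] [HopfAlgebra k H] [Ring Ω] [Algebra k Ω] :
    WithConv (H →ₗ[k] H ⊗[k] Ω) :=
  convPost (Algebra.TensorProduct.includeLeft : H →ₐ[k] H ⊗[k] Ω).toLinearMap
    (toConv (HopfAlgebra.antipode k))

/-- Postcomposition with `x ↦ 1 ⊗ x` on convolution algebras. -/
def convRight {k H Ω : Type*} [CommRing k] [Ring H] [HopfAlgebra k H] [Ring Ω] [Algebra k Ω]
    (f : WithConv (H →ₗ[k] Ω)) : WithConv (H →ₗ[k] H ⊗[k] Ω) :=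
  convPost (Algebra.TensorProduct.includeRight : Ω →ₐ[k] H ⊗[k] Ω).toLinearMap f

lemma convRight_mul (f g : WithConv (H →ₗ[k] Ω)) :
    convRight (f * g) = convRight f * convRight g :=
  convPost_algHom_mul _ f g

lemma convRight_one : convRight (1 : WithConv (H →ₗ[k] Ω)) = 1 :=
  convPost_algHom_one _

lemma convRight_convConst (x : Ω) :
    convRight (convConst k H x) = convConst k H (1 ⊗ₜ[k] x) :=
  convPost_convConst _ x

lemma convLeft_mul_convLeftInv : convLeft k H Ω * convLeftInv k H Ω = 1 := by
  rw [convLeft, convLeftInv, ← convPost_algHom_mul, LinearMap.id_mul_antipode,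
    convPost_algHom_one]

lemma convLeftInv_mul_convLeft : convLeftInv k H Ω * convLeft k H Ω = 1 := by
  rw [convLeft, convLeftInv, ← convPost_algHom_mul, LinearMap.antipode_mul_id,
    convPost_algHom_one]

lemma convLeft_mul_convRight_apply (f : H →ₗ[k] Ω) (h : H) :
    (convLeft k H Ω * convRight (toConv f)) h = LinearMap.lTensor H f (comul h) := by
  rw [(ℛ k h).convMul_apply]
  conv_rhs => rw [← (ℛ k h).eq]
  simp [convLeft, convRight, convPost_apply]

lemma convLeft_comm_convConst (x : Ω) :
    convLeft k H Ω * convConst k H (1 ⊗ₜ[k] x) = convConst k H (1 ⊗ₜ[k] x) * convLeft k H Ω := by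
  rw [← convRight_convConst]
  ext h
  refine (convLeft_mul_convRight_apply _ h).trans ?_
  rw [convRight_convConst]
  refine Eq.trans ?_ (convConst_mul_apply _ _ h).symm
  rw [LinearMap.lTensor_comp_apply, lTensor_counit_comul]
  simp [convLeft, convPost_apply]

lemma IsLeftCovariantH.convPost_convIota (hL : IsLeftCovariantH C ΛL) :
    convPost ΛL (convIota C) = convLeft k H Ω * convRight (convIota C) := by
  ext h
  exact (hL.map_iota h).trans (convLeft_mul_convRight_apply _ h).symm

lemma IsLeftCovariantH.convPost_d_convIota (hL : IsLeftCovariantH C ΛL) :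
    convPost ΛL (convPost C.d (convIota C)) =
      convLeft k H Ω * convRight (convPost C.d (convIota C)) := by
  ext h
  refine Eq.trans ?_ (convLeft_mul_convRight_apply _ h).symm
  rw [LinearMap.lTensor_comp_apply]
  exact (hL.map_d _).trans (congrArg _ (hL.map_iota h))

lemma IsLeftCovariantH.convPost_convAntipode (hL : IsLeftCovariantH C ΛL) :
    convPost ΛL (convAntipode C) = convRight (convAntipode C) * convLeftInv k H Ω := by
  have h1 : convPost ΛL (convAntipode C) * convPost ΛL (convIota C) = 1 := by
    rw [← hL.algHom_toLinearMap, ← convPost_algHom_mul, convAntipode_mul_convIota,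
      convPost_algHom_one]
  have h2 : convPost ΛL (convIota C) *
      (convRight (convAntipode C) * convLeftInv k H Ω) = 1 := by
    rw [hL.convPost_convIota, mul_assoc, ← mul_assoc (convRight (convIota C)), ← convRight_mul,
      convIota_mul_convAntipode, convRight_one, one_mul, convLeft_mul_convLeftInv]
  exact left_inv_eq_right_inv h1 h2

lemma IsLeftCovariantH.adAct_mem (hL : IsLeftCovariantH C ΛL) {x : Ω}
    (hx : x ∈ leftCoinv ΛL) (h : H) : adAct C h x ∈ leftCoinv ΛL := by
  have key : convPost ΛL (convAd C x) = convRight (convAd C x) := by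
    rw [convAd, ← hL.algHom_toLinearMap, convPost_algHom_mul, convPost_algHom_mul,
      hL.algHom_toLinearMap, hL.convPost_convAntipode, hL.convPost_convIota,
      convPost_convConst, mem_leftCoinv.1 hx, convRight_mul, convRight_mul, convRight_convConst]
    calc _ = convRight (convAntipode C) * convLeftInv k H Ω *
          (convConst k H (1 ⊗ₜ[k] x) * convLeft k H Ω) * convRight (convIota C) := by
          simp only [mul_assoc]
      _ = convRight (convAntipode C) * (convLeftInv k H Ω * convLeft k H Ω) *
          convConst k H (1 ⊗ₜ[k] x) * convRight (convIota C) := by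
          rw [← convLeft_comm_convConst]
          simp only [mul_assoc]
      _ = _ := by rw [convLeftInv_mul_convLeft, mul_one]
  rw [adAct_eq_convAd, mem_leftCoinv]
  exact LinearMap.congr_fun (congrArg ofConv key) h

lemma IsLeftCovariantH.cartan_mem (hL : IsLeftCovariantH C ΛL) (h : H) :
    cartan C h ∈ leftCoinv ΛL := by
  have key : convPost ΛL (convCartan C) = convRight (convCartan C) := by
    rw [convCartan, ← hL.algHom_toLinearMap, convPost_algHom_mul,
      hL.algHom_toLinearMap, hL.convPost_convAntipode, hL.convPost_d_convIota,
      mul_assoc, ← mul_assoc (convLeftInv k H Ω), convLeftInv_mul_convLeft, one_mul,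
      convRight_mul]
  rw [cartan_eq_convCartan, mem_leftCoinv]
  exact LinearMap.congr_fun (congrArg ofConv key) h

lemma piLam_of_mem {x : Ω} (hx : x ∈ leftCoinv ΛL) : piLam C ΛL x = x := by
  simp [piLam, mem_leftCoinv.1 hx, HopfAlgebra.antipode_one]

lemma IsLeftCovariantH.piLam_iota_mul (hL : IsLeftCovariantH C ΛL) {x : Ω}
    (hx : x ∈ leftCoinv ΛL) (h : H) :
    piLam C ΛL (C.ι h * x) = counit (R := k) h • x := by
  simp only [piLam, LinearMap.comp_apply]
  rw [hL.2.2.1, hL.map_iota, mem_leftCoinv.1 hx, ← (ℛ k h).eq]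
  simp only [map_sum, LinearMap.lTensor_tmul, Finset.sum_mul,
    Algebra.TensorProduct.tmul_mul_tmul, mul_one, TensorProduct.map_tmul, LinearMap.mul'_apply,
    LinearMap.comp_apply, AlgHom.toLinearMap_apply, LinearMap.id_apply, ← mul_assoc]
  simp only [← Finset.sum_mul, ← map_mul, ← map_sum, HopfAlgebra.sum_antipode_mul_eq_smul,
    map_smul, map_one, smul_mul_assoc, one_mul]

variable (C) in
/-- The subalgebra of forms generated by the image of the Cartan–Maurer map. -/
def cartanAlg : Subalgebra k Ω := Algebra.adjoin k (Set.range (cartan C))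

lemma cartan_mem_cartanAlg (h : H) : cartan C h ∈ cartanAlg C :=
  Algebra.subset_adjoin ⟨h, rfl⟩

lemma IsLeftCovariantH.cartanAlg_le (hL : IsLeftCovariantH C ΛL) {x : Ω}
    (hx : x ∈ cartanAlg C) : x ∈ leftCoinv ΛL := by
  induction hx using Algebra.adjoin_induction with
  | mem x hx =>
    obtain ⟨h, rfl⟩ := hx
    exact hL.cartan_mem h
  | algebraMap r =>
    rw [Algebra.algebraMap_eq_smul_one]
    exact Submodule.smul_mem _ _ hL.one_mem
  | add x y _ _ hx hy => exact Submodule.add_mem _ hx hy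
  | mul x y _ _ hx hy => exact hL.mul_mem hx hy

lemma adAct_mem_cartanAlg {x : Ω} (hx : x ∈ cartanAlg C) (h : H) :
    adAct C h x ∈ cartanAlg C := by
  induction hx using Algebra.adjoin_induction generalizing h with
  | mem x hx =>
    obtain ⟨g, rfl⟩ := hx
    rw [← sub_eq_of_eq_add (cartan_mul C g h)]
    exact Subalgebra.sub_mem _ (cartan_mem_cartanAlg _)
      (Subalgebra.smul_mem _ (cartan_mem_cartanAlg _) _)
  | algebraMap r =>
    rw [Algebra.algebraMap_eq_smul_one, map_smul, adAct_eq_convAd, convAd_one]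
    exact Subalgebra.smul_mem _ (Subalgebra.algebraMap_mem _ _) _
  | add x y _ _ hx hy =>
    rw [map_add]
    exact Subalgebra.add_mem _ (hx h) (hy h)
  | mul x y _ _ hx hy =>
    rw [adAct_eq_convAd, convAd_mul, (ℛ k h).convMul_apply]
    refine Subalgebra.sum_mem _ fun i _ => ?_
    simp only [← adAct_eq_convAd]
    exact Subalgebra.mul_mem _ (hx _) (hy _)

variable (C) in
/-- The span of the products `h · ϑ` with `h ∈ H` and `ϑ` generated by the Cartan–Maurer
image. -/
def iotaMulCartan : Submodule k Ω :=
  Submodule.span k {x | ∃ h : H, ∃ u ∈ cartanAlg C, x = C.ι h * u}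

lemma iota_mul_mem_iotaMulCartan (g : H) {x : Ω} (hx : x ∈ iotaMulCartan C) :
    C.ι g * x ∈ iotaMulCartan C := by
  induction hx using Submodule.span_induction with
  | mem x hx =>
    obtain ⟨h, u, hu, rfl⟩ := hx
    exact Submodule.subset_span ⟨g * h, u, hu, by rw [map_mul, mul_assoc]⟩
  | zero => simp
  | add x y _ _ hx hy =>
    rw [mul_add]
    exact Submodule.add_mem _ hx hy
  | smul c x _ hx =>
    rw [mul_smul_comm]
    exact Submodule.smul_mem _ _ hx

lemma cartan_mul_mem_iotaMulCartan (g : H) {x : Ω} (hx : x ∈ iotaMulCartan C) :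
    cartan C g * x ∈ iotaMulCartan C := by
  induction hx using Submodule.span_induction with
  | mem x hx =>
    obtain ⟨h, u, hu, rfl⟩ := hx
    rw [← mul_assoc, mul_iota_eq_sum, Finset.sum_mul]
    refine Submodule.sum_mem _ fun i _ => Submodule.subset_span ⟨_, _, ?_, mul_assoc _ _ _⟩
    exact Subalgebra.mul_mem _ (adAct_mem_cartanAlg (cartan_mem_cartanAlg g) _) hu
  | zero => simp
  | add x y _ _ hx hy =>
    rw [mul_add]
    exact Submodule.add_mem _ hx hy
  | smul c x _ hx =>
    rw [mul_smul_comm]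
    exact Submodule.smul_mem _ _ hx

lemma iotaMulCartan_eq_top : iotaMulCartan C = ⊤ := by
  have key : ∀ y ∈ Algebra.adjoin k (Set.range C.ι ∪ ⇑C.d '' Set.range C.ι),
      ∀ x ∈ iotaMulCartan C, y * x ∈ iotaMulCartan C := by
    intro y hy
    induction hy using Algebra.adjoin_induction with
    | mem y hy =>
      intro x hx
      rcases hy with ⟨h, rfl⟩ | ⟨_, ⟨h, rfl⟩, rfl⟩
      · exact iota_mul_mem_iotaMulCartan h hx
      · rw [d_iota_eq_sum, Finset.sum_mul]
        refine Submodule.sum_mem _ fun i _ => ?_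
        rw [mul_assoc]
        exact iota_mul_mem_iotaMulCartan _ (cartan_mul_mem_iotaMulCartan _ hx)
    | algebraMap r =>
      intro x hx
      rw [← Algebra.smul_def]
      exact Submodule.smul_mem _ _ hx
    | add y z _ _ hy hz =>
      intro x hx
      rw [add_mul]
      exact Submodule.add_mem _ (hy x hx) (hz x hx)
    | mul y z _ _ hy hz =>
      intro x hx
      rw [mul_assoc]
      exact hy _ (hz x hx)
  refine Submodule.eq_top_iff'.2 fun y => ?_
  have h1 : (1 : Ω) ∈ iotaMulCartan C :=
    Submodule.subset_span ⟨1, 1, Subalgebra.one_mem _, by simp⟩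
  simpa using key y (C.generated ▸ Algebra.mem_top) 1 h1

/-- Left-coinvariant forms are generated by the Cartan–Maurer image. -/
lemma IsLeftCovariantH.leftCoinv_le_cartanAlg (hL : IsLeftCovariantH C ΛL) {x : Ω}
    (hx : x ∈ leftCoinv ΛL) : x ∈ cartanAlg C := by
  have key : ∀ y ∈ iotaMulCartan C, piLam C ΛL y ∈ cartanAlg C := by
    intro y hy
    induction hy using Submodule.span_induction with
    | mem y hy =>
      obtain ⟨h, u, hu, rfl⟩ := hy
      rw [hL.piLam_iota_mul (hL.cartanAlg_le hu)]
      exact Subalgebra.smul_mem _ hu _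
    | zero => simp
    | add y z _ _ hy hz =>
      rw [map_add]
      exact Subalgebra.add_mem _ hy hz
    | smul c y _ hy =>
      rw [map_smul]
      exact Subalgebra.smul_mem _ hy _
  rw [← piLam_of_mem (C := C) hx]
  exact key x (iotaMulCartan_eq_top (C := C) ▸ Submodule.mem_top)

end LeftCoinvariants

section VerticalForms

open Coalgebra WithConv

variable {k : Type*} [CommRing k]
variable {H : Type*} [Ring H] [HopfAlgebra k H]
variable {A : Type*} [Ring A] [Algebra k A]
variable {Ω : Type*} [Ring Ω] [Algebra k Ω]
variable (S : ComodAlg k H A)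

/-- The map `a ↦ a₀ ⊗ F(a₁)`. -/
def coactMap (F : WithConv (H →ₗ[k] Ω)) : A →ₗ[k] A ⊗[k] Ω :=
  LinearMap.lTensor A F.ofConv ∘ₗ S.ρ.toLinearMap

lemma ComodAlg.exists_finset (a : A) :
    ∃ s : Finset (A × H), S.ρ a = ∑ i ∈ s, i.1 ⊗ₜ[k] i.2 :=
  TensorProduct.exists_finset _

variable {S}

lemma coactMap_eq_sum {a : A} {s : Finset (A × H)} (hs : S.ρ a = ∑ i ∈ s, i.1 ⊗ₜ[k] i.2)
    (F : WithConv (H →ₗ[k] Ω)) : coactMap S F a = ∑ i ∈ s, i.1 ⊗ₜ[k] F i.2 := by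
  simp [coactMap, hs]

lemma coactMap_mul_eq_sum {a : A} {s : Finset (A × H)} (hs : S.ρ a = ∑ i ∈ s, i.1 ⊗ₜ[k] i.2)
    (F G : WithConv (H →ₗ[k] Ω)) :
    coactMap S (F * G) a = ∑ i ∈ s, coactMap S F i.1 * (1 ⊗ₜ[k] G i.2) := by
  have h := congrArg
    (LinearMap.lTensor A (LinearMap.mul' k Ω ∘ₗ TensorProduct.map F.ofConv G.ofConv))
    (LinearMap.congr_fun S.coaction.2 a)
  have h1 : ∀ (x : A ⊗[k] H) (g : H),
      LinearMap.lTensor A (LinearMap.mul' k Ω ∘ₗ TensorProduct.map F.ofConv G.ofConv)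
        (TensorProduct.assoc k A H H (x ⊗ₜ[k] g)) =
      LinearMap.lTensor A F.ofConv x * (1 ⊗ₜ[k] G g) := by
    intro x g
    induction x with
    | zero => simp
    | tmul b h => simp
    | add x y hx hy => simp only [TensorProduct.add_tmul, map_add, hx, hy, add_mul]
  simp only [LinearMap.comp_apply, AlgHom.toLinearMap_apply, hs, map_sum, LinearMap.rTensor_tmul,
    LinearEquiv.coe_coe, h1] at h
  simp only [coactMap, LinearMap.comp_apply, AlgHom.toLinearMap_apply, h, hs, map_sum]
  simp [LinearMap.convMul_def]

lemma coactMap_apply_mul {a : A} {s : Finset (A × H)} (hs : S.ρ a = ∑ i ∈ s, i.1 ⊗ₜ[k] i.2)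
    (F : WithConv (H →ₗ[k] Ω)) (b : A) :
    coactMap S F (a * b) = ∑ i ∈ s, (i.1 ⊗ₜ[k] (1 : Ω)) *
      coactMap S (toConv (F.ofConv ∘ₗ LinearMap.mulLeft k i.2)) b := by
  obtain ⟨t, ht⟩ := S.exists_finset b
  simp only [coactMap, LinearMap.comp_apply, AlgHom.toLinearMap_apply, map_mul, hs, ht,
    Finset.sum_mul_sum]
  simp [Finset.mul_sum]

lemma ComodAlg.sum_counit_smul {a : A} {s : Finset (A × H)}
    (hs : S.ρ a = ∑ i ∈ s, i.1 ⊗ₜ[k] i.2) : ∑ i ∈ s, counit (R := k) i.2 • i.1 = a := by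
  have h := congrArg (TensorProduct.rid k A) (LinearMap.congr_fun S.coaction.1 a)
  simpa [hs] using h

lemma coactMap_one (a : A) : coactMap S (1 : WithConv (H →ₗ[k] Ω)) a = a ⊗ₜ[k] 1 := by
  obtain ⟨s, hs⟩ := S.exists_finset a
  rw [coactMap_eq_sum hs]
  simp only [LinearMap.convOne_apply, Algebra.algebraMap_eq_smul_one, ← TensorProduct.smul_tmul,
    ← TensorProduct.sum_tmul, S.sum_counit_smul hs]

lemma coactMap_apply_one (F : WithConv (H →ₗ[k] Ω)) : coactMap S F 1 = 1 ⊗ₜ[k] F 1 := by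
  simp [coactMap, Algebra.TensorProduct.one_def]

lemma coactMap_add (F G : WithConv (H →ₗ[k] Ω)) :
    coactMap S (F + G) = coactMap S F + coactMap S G := by
  simp [coactMap, LinearMap.lTensor_add, LinearMap.add_comp]

lemma coactMap_smul (c : k) (F : WithConv (H →ₗ[k] Ω)) :
    coactMap S (c • F) = c • coactMap S F := by
  simp [coactMap, LinearMap.lTensor_smul, LinearMap.smul_comp]

variable (C : DiffCalc k H Ω)

lemma verMul_tmul (a b : A) (θ η : Ω) :
    verMul S C ((a ⊗ₜ[k] θ) ⊗ₜ[k] (b ⊗ₜ[k] η)) =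
      (a ⊗ₜ[k] 1) * coactMap S (convAd C θ) b * (1 ⊗ₜ[k] η) := by
  obtain ⟨s, hs⟩ := S.exists_finset b
  rw [coactMap_eq_sum hs]
  simp [verMul, hs, TensorProduct.sum_tmul, TensorProduct.tmul_sum, Finset.mul_sum,
    Finset.sum_mul, ← adAct_eq_convAd]

lemma verMul_tmul_eq_sum (a : A) {b : A} {s : Finset (A × H)}
    (hs : S.ρ b = ∑ i ∈ s, i.1 ⊗ₜ[k] i.2) (θ η : Ω) :
    verMul S C ((a ⊗ₜ[k] θ) ⊗ₜ[k] (b ⊗ₜ[k] η)) =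
      ∑ i ∈ s, (a * i.1) ⊗ₜ[k] (adAct C i.2 θ * η) := by
  rw [verMul_tmul, coactMap_eq_sum hs]
  simp [Finset.mul_sum, Finset.sum_mul, ← adAct_eq_convAd]

lemma verD_tmul (a : A) (θ : Ω) :
    verD S C (a ⊗ₜ[k] θ) = a ⊗ₜ[k] C.d θ + coactMap S (convCartan C) a * (1 ⊗ₜ[k] θ) := by
  obtain ⟨s, hs⟩ := S.exists_finset a
  rw [coactMap_eq_sum hs]
  simp [verD, hs, TensorProduct.sum_tmul, Finset.sum_mul, ← cartan_eq_convCartan]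

lemma verD_tmul_eq_sum {a : A} {s : Finset (A × H)}
    (hs : S.ρ a = ∑ i ∈ s, i.1 ⊗ₜ[k] i.2) (θ : Ω) :
    verD S C (a ⊗ₜ[k] θ) = a ⊗ₜ[k] C.d θ + ∑ i ∈ s, i.1 ⊗ₜ[k] (cartan C i.2 * θ) := by
  rw [verD_tmul, coactMap_eq_sum hs]
  simp [Finset.sum_mul, ← cartan_eq_convCartan]

lemma coactMap_convAd_mul {b : A} {s : Finset (A × H)}
    (hs : S.ρ b = ∑ i ∈ s, i.1 ⊗ₜ[k] i.2) (θ : Ω) (c : A) :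
    coactMap S (convAd C θ) (b * c) = ∑ i ∈ s, (i.1 ⊗ₜ[k] (1 : Ω)) *
      coactMap S (convAd C (adAct C i.2 θ)) c := by
  rw [coactMap_apply_mul hs]
  refine Finset.sum_congr rfl fun i _ => ?_
  congr 2
  congr 1
  ext h
  change (convAd C θ) (i.2 * h) = (convAd C (adAct C i.2 θ)) h
  rw [← adAct_eq_convAd, ← adAct_eq_convAd, adAct_mul]

lemma coactMap_convCartan_mul {b : A} {s : Finset (A × H)}
    (hs : S.ρ b = ∑ i ∈ s, i.1 ⊗ₜ[k] i.2) (c : A) :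
    coactMap S (convCartan C) (b * c) = ∑ i ∈ s, (i.1 ⊗ₜ[k] (1 : Ω)) *
      coactMap S (convAd C (cartan C i.2)) c + (b ⊗ₜ[k] 1) * coactMap S (convCartan C) c := by
  rw [coactMap_apply_mul hs]
  have h1 : ∀ g : H, toConv ((convCartan C).ofConv ∘ₗ LinearMap.mulLeft k g) =
      convAd C (cartan C g) + counit (R := k) g • convCartan C := by
    intro g
    ext h
    change (convCartan C) (g * h) =
      (convAd C (cartan C g)) h + counit (R := k) g • (convCartan C) h
    rw [← adAct_eq_convAd, ← cartan_eq_convCartan, ← cartan_eq_convCartan, cartan_mul]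
  simp only [h1, coactMap_add, coactMap_smul, LinearMap.add_apply, LinearMap.smul_apply, mul_add,
    Finset.sum_add_distrib]
  congr 1
  conv_rhs => rw [← S.sum_counit_smul hs]
  simp only [TensorProduct.sum_tmul, Finset.sum_mul, mul_smul_comm, smul_mul_assoc,
    ← TensorProduct.smul_tmul']

lemma verMul_assoc (x y z : A ⊗[k] Ω) :
    verMul S C (verMul S C (x ⊗ₜ[k] y) ⊗ₜ[k] z) =
      verMul S C (x ⊗ₜ[k] verMul S C (y ⊗ₜ[k] z)) := by
  induction x with
  | zero => simp
  | add x x' hx hx' => simp only [TensorProduct.add_tmul, map_add, hx, hx']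
  | tmul a θ =>
  induction y with
  | zero => simp
  | add y y' hy hy' => simp only [TensorProduct.add_tmul, TensorProduct.tmul_add, map_add, hy, hy']
  | tmul b ϑ =>
  induction z with
  | zero => simp
  | add z z' hz hz' => simp only [TensorProduct.tmul_add, map_add, hz, hz']
  | tmul c η =>
  obtain ⟨s, hs⟩ := S.exists_finset b
  obtain ⟨t, ht⟩ := S.exists_finset c
  rw [verMul_tmul_eq_sum C a hs, verMul_tmul_eq_sum C b ht]
  simp only [TensorProduct.sum_tmul, TensorProduct.tmul_sum, map_sum, verMul_tmul,
    coactMap_convAd_mul C hs, convAd_mul, coactMap_mul_eq_sum ht, Finset.mul_sum, Finset.sum_mul]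
  rw [Finset.sum_comm]
  refine Finset.sum_congr rfl fun j _ => Finset.sum_congr rfl fun i _ => ?_
  have h1 : ((a * i.1) ⊗ₜ[k] (1 : Ω)) = (a ⊗ₜ[k] 1) * (i.1 ⊗ₜ[k] 1) := by simp
  have h2 : ((1 : A) ⊗ₜ[k] (adAct C j.2 ϑ * η)) =
      (1 ⊗ₜ[k] adAct C j.2 ϑ) * (1 ⊗ₜ[k] η) := by simp
  rw [h1, h2, ← adAct_eq_convAd]
  simp only [mul_assoc]

lemma one_verMul (x : A ⊗[k] Ω) : verMul S C ((1 ⊗ₜ[k] 1) ⊗ₜ[k] x) = x := by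
  induction x with
  | zero => simp
  | add x x' hx hx' => simp only [TensorProduct.tmul_add, map_add, hx, hx']
  | tmul a θ => simp [verMul_tmul, convAd_one, coactMap_one]

lemma verMul_one (x : A ⊗[k] Ω) : verMul S C (x ⊗ₜ[k] (1 ⊗ₜ[k] 1)) = x := by
  induction x with
  | zero => simp
  | add x x' hx hx' => simp only [TensorProduct.add_tmul, map_add, hx, hx']
  | tmul a θ => simp [verMul_tmul, coactMap_apply_one, ← adAct_eq_convAd, adAct_one]

lemma verD_verD (x : A ⊗[k] Ω) : verD S C (verD S C x) = 0 := by
  induction x with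
  | zero => simp
  | add x x' hx hx' => simp only [map_add, hx, hx', add_zero]
  | tmul a θ =>
  obtain ⟨s, hs⟩ := S.exists_finset a
  have h1 : ∀ h, C.d (cartan C h * θ) = C.d (cartan C h) * θ - cartan C h * C.d θ := by
    intro h
    rw [C.leibniz 1 (cartan C h) (convCartan_mem C h), pow_one, neg_smul, one_smul, sub_eq_add_neg]
  have h2 : ∑ i ∈ s, i.1 ⊗ₜ[k] (C.d (cartan C i.2) * θ) =
      coactMap S (convPost C.d (convCartan C)) a * (1 ⊗ₜ[k] θ) := by
    rw [coactMap_eq_sum hs]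
    simp [Finset.sum_mul, convPost_apply, cartan_eq_convCartan]
  have h3 : ∑ i ∈ s, coactMap S (convCartan C) i.1 * (1 ⊗ₜ[k] (cartan C i.2 * θ)) =
      coactMap S (convCartan C * convCartan C) a * (1 ⊗ₜ[k] θ) := by
    rw [coactMap_mul_eq_sum hs, Finset.sum_mul]
    simp [mul_assoc, cartan_eq_convCartan]
  have h4 : coactMap S (-(convCartan C * convCartan C)) a =
      -coactMap S (convCartan C * convCartan C) a := by
    rw [← neg_one_smul k, coactMap_smul, LinearMap.smul_apply, neg_one_smul]
  rw [verD_tmul_eq_sum C hs, map_add, verD_tmul_eq_sum C hs, C.d_d, TensorProduct.tmul_zero,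
    zero_add, map_sum]
  simp only [verD_tmul, h1, TensorProduct.tmul_sub, Finset.sum_add_distrib,
    Finset.sum_sub_distrib, h2, h3, convPost_d_convCartan, h4]
  rw [neg_mul]
  abel

lemma verD_verMul_tmul {n : ℕ} {θ : Ω} (hθ : θ ∈ C.grading n) (a : A) (y : A ⊗[k] Ω) :
    verD S C (verMul S C ((a ⊗ₜ[k] θ) ⊗ₜ[k] y)) =
      verMul S C (verD S C (a ⊗ₜ[k] θ) ⊗ₜ[k] y) +
        ((-1 : k) ^ n) • verMul S C ((a ⊗ₜ[k] θ) ⊗ₜ[k] verD S C y) := by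
  induction y with
  | zero => simp
  | add y y' hy hy' =>
    simp only [TensorProduct.tmul_add, map_add, hy, hy', smul_add]
    abel
  | tmul b η =>
  obtain ⟨s, hs⟩ := S.exists_finset a
  obtain ⟨t, ht⟩ := S.exists_finset b
  have h1 : ∀ h, C.d (adAct C h θ * η) =
      C.d (adAct C h θ) * η + ((-1 : k) ^ n) • (adAct C h θ * C.d η) := by
    intro h
    rw [adAct_eq_convAd]
    exact C.leibniz n _ (convAd_mem C hθ h) _
  have hl1 : ∑ i ∈ t, (a * i.1) ⊗ₜ[k] (C.d (adAct C i.2 θ) * η) =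
      (a ⊗ₜ[k] 1) * coactMap S (convPost C.d (convAd C θ)) b * (1 ⊗ₜ[k] η) := by
    rw [coactMap_eq_sum ht]
    simp [Finset.sum_mul, Finset.mul_sum, convPost_apply, adAct_eq_convAd]
  have hl2 : ∑ i ∈ t, coactMap S (convCartan C) (a * i.1) * (1 ⊗ₜ[k] (adAct C i.2 θ * η)) =
      ∑ l ∈ s, (l.1 ⊗ₜ[k] 1) * coactMap S (convAd C (cartan C l.2 * θ)) b * (1 ⊗ₜ[k] η) +
      (a ⊗ₜ[k] 1) * coactMap S (convCartan C * convAd C θ) b * (1 ⊗ₜ[k] η) := by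
    have h2 : ∀ x : Ω, ((1 : A) ⊗ₜ[k] (x * η)) = (1 ⊗ₜ[k] x) * (1 ⊗ₜ[k] η) := by simp
    simp only [coactMap_convCartan_mul C hs, convAd_mul, coactMap_mul_eq_sum ht, h2,
      adAct_eq_convAd, add_mul, Finset.sum_add_distrib, Finset.sum_mul, Finset.mul_sum, mul_assoc]
    rw [Finset.sum_comm]
  have hr : ∑ i ∈ t, verMul S C ((a ⊗ₜ[k] θ) ⊗ₜ[k] (i.1 ⊗ₜ[k] (cartan C i.2 * η))) =
      (a ⊗ₜ[k] 1) * coactMap S (convAd C θ * convCartan C) b * (1 ⊗ₜ[k] η) := by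
    simp only [verMul_tmul, coactMap_mul_eq_sum ht, Finset.mul_sum, Finset.sum_mul]
    refine Finset.sum_congr rfl fun i _ => ?_
    have h2 : ((1 : A) ⊗ₜ[k] (cartan C i.2 * η)) = (1 ⊗ₜ[k] cartan C i.2) * (1 ⊗ₜ[k] η) := by
      simp
    rw [h2, cartan_eq_convCartan]
    simp only [mul_assoc]
  have hd := congrArg (fun F => (a ⊗ₜ[k] (1 : Ω)) * coactMap S F b * (1 ⊗ₜ[k] η))
    (convPost_d_convAd C hθ)
  simp only [coactMap_add, coactMap_smul, LinearMap.add_apply, LinearMap.smul_apply, mul_add,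
    add_mul, mul_smul_comm, smul_mul_assoc] at hd
  have hlhs : verD S C (verMul S C ((a ⊗ₜ[k] θ) ⊗ₜ[k] (b ⊗ₜ[k] η))) =
      ((a ⊗ₜ[k] 1) * coactMap S (convPost C.d (convAd C θ)) b * (1 ⊗ₜ[k] η) +
        ((-1 : k) ^ n) • verMul S C ((a ⊗ₜ[k] θ) ⊗ₜ[k] (b ⊗ₜ[k] C.d η))) +
      (∑ l ∈ s, (l.1 ⊗ₜ[k] 1) * coactMap S (convAd C (cartan C l.2 * θ)) b * (1 ⊗ₜ[k] η) +
      (a ⊗ₜ[k] 1) * coactMap S (convCartan C * convAd C θ) b * (1 ⊗ₜ[k] η)) := by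
    rw [verMul_tmul_eq_sum C a ht, map_sum, ← hl1, ← hl2, verMul_tmul_eq_sum C a ht]
    simp only [verD_tmul, h1, TensorProduct.tmul_add, TensorProduct.tmul_smul,
      Finset.sum_add_distrib, Finset.smul_sum]
  have hrhs : verMul S C (verD S C (a ⊗ₜ[k] θ) ⊗ₜ[k] (b ⊗ₜ[k] η)) =
      (a ⊗ₜ[k] 1) * coactMap S (convAd C (C.d θ)) b * (1 ⊗ₜ[k] η) +
      ∑ l ∈ s, (l.1 ⊗ₜ[k] 1) * coactMap S (convAd C (cartan C l.2 * θ)) b * (1 ⊗ₜ[k] η) := by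
    rw [verD_tmul_eq_sum C hs]
    simp only [TensorProduct.add_tmul, TensorProduct.sum_tmul, map_add, map_sum, verMul_tmul]
  rw [hlhs, hrhs, verD_tmul_eq_sum C ht, TensorProduct.tmul_add, TensorProduct.tmul_sum, map_add,
    map_sum, hr, smul_add, add_right_comm _ _ (_ + _), ← add_assoc, add_right_comm _ (∑ _ ∈ _, _),
    hd]
  abel

variable {C} {ΛL : Ω →ₗ[k] H ⊗[k] Ω}

lemma tmul_mem_verSub (a : A) {θ : Ω} (hθ : θ ∈ leftCoinv ΛL) : a ⊗ₜ[k] θ ∈ verSub A ΛL :=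
  ⟨a ⊗ₜ[k] ⟨θ, hθ⟩, rfl⟩

lemma tmul_mem_verSubN {n : ℕ} (a : A) {θ : Ω} (hθ : θ ∈ leftCoinv ΛL)
    (hn : θ ∈ C.grading n) : a ⊗ₜ[k] θ ∈ verSubN A C ΛL n :=
  ⟨a ⊗ₜ[k] ⟨θ, hθ, hn⟩, rfl⟩

lemma verSub_induction {p : A ⊗[k] Ω → Prop} (zero : p 0)
    (add : ∀ x y, p x → p y → p (x + y))
    (tmul : ∀ a : A, ∀ θ ∈ leftCoinv ΛL, p (a ⊗ₜ[k] θ)) {x : A ⊗[k] Ω}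
    (hx : x ∈ verSub A ΛL) : p x := by
  obtain ⟨t, rfl⟩ := hx
  induction t with
  | zero => simpa using zero
  | add t t' ht ht' => simpa using add _ _ ht ht'
  | tmul a θ => exact tmul a θ θ.2

lemma verSubN_induction {n : ℕ} {p : A ⊗[k] Ω → Prop} (zero : p 0)
    (add : ∀ x y, p x → p y → p (x + y))
    (tmul : ∀ a : A, ∀ θ ∈ leftCoinv ΛL, θ ∈ C.grading n → p (a ⊗ₜ[k] θ)) {x : A ⊗[k] Ω}
    (hx : x ∈ verSubN A C ΛL n) : p x := by
  obtain ⟨t, rfl⟩ := hx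
  induction t with
  | zero => simpa using zero
  | add t t' ht ht' => simpa using add _ _ ht ht'
  | tmul a θ => exact tmul a θ θ.2.1 θ.2.2

lemma verMul_mem_verSub (hL : IsLeftCovariantH C ΛL) {x y : A ⊗[k] Ω}
    (hx : x ∈ verSub A ΛL) (hy : y ∈ verSub A ΛL) :
    verMul S C (x ⊗ₜ[k] y) ∈ verSub A ΛL := by
  refine verSub_induction (p := fun x => verMul S C (x ⊗ₜ[k] y) ∈ verSub A ΛL)
    (by simp) (fun x x' hx hx' => ?_) (fun a θ hθ => ?_) hx
  · rw [TensorProduct.add_tmul, map_add]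
    exact Submodule.add_mem _ hx hx'
  refine verSub_induction (p := fun y => verMul S C ((a ⊗ₜ[k] θ) ⊗ₜ[k] y) ∈ verSub A ΛL)
    (by simp) (fun y y' hy hy' => ?_) (fun b η hη => ?_) hy
  · rw [TensorProduct.tmul_add, map_add]
    exact Submodule.add_mem _ hy hy'
  obtain ⟨s, hs⟩ := S.exists_finset b
  rw [verMul_tmul_eq_sum C a hs]
  exact Submodule.sum_mem _ fun i _ => tmul_mem_verSub _ (hL.mul_mem (hL.adAct_mem hθ _) hη)

lemma verD_mem_verSubN (hL : IsLeftCovariantH C ΛL) {n : ℕ} {x : A ⊗[k] Ω}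
    (hx : x ∈ verSubN A C ΛL n) : verD S C x ∈ verSubN A C ΛL (n + 1) := by
  let := C.gradedAlgebra
  refine verSubN_induction (p := fun x => verD S C x ∈ verSubN A C ΛL (n + 1))
    (by simp) (fun x y hx hy => ?_) (fun a θ hθ hn => ?_) hx
  · rw [map_add]
    exact Submodule.add_mem _ hx hy
  obtain ⟨s, hs⟩ := S.exists_finset a
  rw [verD_tmul_eq_sum C hs]
  refine Submodule.add_mem _ (tmul_mem_verSubN _ (hL.d_mem hθ) (C.d_mem n θ hn))
    (Submodule.sum_mem _ fun i _ =>
      tmul_mem_verSubN _ (hL.mul_mem (hL.cartan_mem _) hθ) ?_)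
  rw [add_comm n 1]
  exact SetLike.mul_mem_graded (convCartan_mem C _) hn

lemma verD_verMul {n : ℕ} {x : A ⊗[k] Ω} (hx : x ∈ verSubN A C ΛL n) (y : A ⊗[k] Ω) :
    verD S C (verMul S C (x ⊗ₜ[k] y)) =
      verMul S C (verD S C x ⊗ₜ[k] y) +
        ((-1 : k) ^ n) • verMul S C (x ⊗ₜ[k] verD S C y) := by
  refine verSubN_induction (p := fun x => verD S C (verMul S C (x ⊗ₜ[k] y)) =
    verMul S C (verD S C x ⊗ₜ[k] y) + ((-1 : k) ^ n) • verMul S C (x ⊗ₜ[k] verD S C y))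
    (by simp) (fun x x' hx hx' => ?_) (fun a θ _ hn => ?_) hx
  · simp only [TensorProduct.add_tmul, map_add, hx, hx', smul_add]
    abel
  · exact verD_verMul_tmul C hn a y

lemma chiAux_tmul {a b : A} {s : Finset (A × H)} (hs : S.ρ b = ∑ i ∈ s, i.1 ⊗ₜ[k] i.2) :
    chiAux S (a ⊗ₜ[k] b) = ∑ i ∈ s, (a * i.1) ⊗ₜ[k] i.2 := by
  simp [chiAux, hs]

/-- `a d_v(b) = a b₀ ⊗ ϖ(b₁)` is the image of `a ⊗ b` under the canonical map followed by the
Cartan–Maurer map. -/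
lemma verMul_verD_eq_chiAux (a b : A) :
    verMul S C ((a ⊗ₜ[k] 1) ⊗ₜ[k] verD S C (b ⊗ₜ[k] 1)) =
      LinearMap.lTensor A (cartan C) (chiAux S (a ⊗ₜ[k] b)) := by
  obtain ⟨s, hs⟩ := S.exists_finset b
  rw [chiAux_tmul hs, verD_tmul_eq_sum C hs, C.map_one_eq_zero]
  simp [TensorProduct.tmul_sum, verMul_tmul, convAd_one, coactMap_one]

lemma verSub_le_of_closed (hL : IsLeftCovariantH C ΛL)
    (hχ : Function.Surjective (chiAux S)) (W : Submodule k (A ⊗[k] Ω))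
    (hA : ∀ a : A, a ⊗ₜ[k] (1 : Ω) ∈ W)
    (hmul : ∀ x ∈ W, ∀ y ∈ W, verMul S C (x ⊗ₜ[k] y) ∈ W)
    (hd : ∀ x ∈ W, verD S C x ∈ W) : verSub A ΛL ≤ W := by
  have hcartan : ∀ z, LinearMap.lTensor A (cartan C) (chiAux S z) ∈ W := by
    intro z
    induction z with
    | zero => simp
    | add x y hx hy =>
      rw [map_add, map_add]
      exact Submodule.add_mem _ hx hy
    | tmul a b =>
      rw [← verMul_verD_eq_chiAux]
      exact hmul _ (hA a) _ (hd _ (hA b))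
  have halg : ∀ u ∈ cartanAlg C, (1 : A) ⊗ₜ[k] u ∈ W := by
    intro u hu
    induction hu using Algebra.adjoin_induction with
    | mem u hu =>
      obtain ⟨h, rfl⟩ := hu
      obtain ⟨z, hz⟩ := hχ (1 ⊗ₜ[k] h)
      simpa [hz] using hcartan z
    | algebraMap r =>
      rw [Algebra.algebraMap_eq_smul_one, TensorProduct.tmul_smul]
      exact Submodule.smul_mem _ _ (hA 1)
    | add x y _ _ hx hy =>
      rw [TensorProduct.tmul_add]
      exact Submodule.add_mem _ hx hy
    | mul x y _ _ hx hy =>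
      simpa [verMul_tmul, coactMap_apply_one, ← adAct_eq_convAd, adAct_one] using hmul _ hx _ hy
  intro x hx
  refine verSub_induction (Submodule.zero_mem _) (fun _ _ => Submodule.add_mem _)
    (fun a θ hθ => ?_) hx
  simpa [verMul_tmul, convAd_one, coactMap_one] using
    hmul _ (hA a) _ (halg θ (hL.leftCoinv_le_cartanAlg hθ))

end VerticalForms

/-- For a quantum principal bundle `B = A^{co H} ⊆ A` and
`Ω•(H)` the maximal prolongation of a bicovariant FODC on `H`, the vertical
forms `ver• = A ⊗ Λ•`, equipped with
`(a ⊗ ϑ) ∧ (a' ⊗ ϑ') = a a'₍₀₎ ⊗ (ϑ ↼ a'₍₁₎) ∧ ϑ'` and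
`d_v(a ⊗ ϑ) = a ⊗ dϑ + a₍₀₎ ⊗ ϖ(π_ε(a₍₁₎)) ∧ ϑ`, form a differential
calculus on `A`: the product is associative and unital, `d_v` is a square-zero
degree-one differential satisfying the graded Leibniz rule, and `ver•` is
generated in degree zero by `A ⊗ k`. -/
theorem verticalForms_isDifferentialCalculus
    {k : Type*} [Field k] {H : Type*} [Ring H] [HopfAlgebra k H]
    (hS : Function.Bijective (HopfAlgebra.antipode (R := k) (A := H)))
    {A : Type*} [Ring A] [Algebra k A] (S : ComodAlg k H A) (hQPB : S.IsQPB)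
    {ΩH : Type*} [Ring ΩH] [Algebra k ΩH] (CH : DiffCalc k H ΩH)
    (ΔR : ΩH →ₗ[k] ΩH ⊗[k] H) (ΛL : ΩH →ₗ[k] H ⊗[k] ΩH)
    (hbicov : IsBicovariantH CH ΔR ΛL) (hmax : IsMaxProl (k := k) CH) :
    -- the operations preserve `A ⊗ Λ•`
    (∀ x ∈ verSub A ΛL, ∀ y ∈ verSub A ΛL,
      verMul S CH (x ⊗ₜ[k] y) ∈ verSub A ΛL) ∧
    -- associativity
    (∀ x ∈ verSub A ΛL, ∀ y ∈ verSub A ΛL, ∀ z ∈ verSub A ΛL,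
      verMul S CH (verMul S CH (x ⊗ₜ[k] y) ⊗ₜ[k] z) =
        verMul S CH (x ⊗ₜ[k] verMul S CH (y ⊗ₜ[k] z))) ∧
    -- unitality
    (∀ x ∈ verSub A ΛL,
      verMul S CH (((1 : A) ⊗ₜ[k] (1 : ΩH)) ⊗ₜ[k] x) = x ∧
      verMul S CH (x ⊗ₜ[k] ((1 : A) ⊗ₜ[k] (1 : ΩH))) = x) ∧
    -- `d_v` has degree one
    (∀ n : ℕ, ∀ x ∈ verSubN A CH ΛL n, verD S CH x ∈ verSubN A CH ΛL (n + 1)) ∧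
    -- `d_v ∘ d_v = 0`
    (∀ x ∈ verSub A ΛL, verD S CH (verD S CH x) = 0) ∧
    -- graded Leibniz rule
    (∀ n : ℕ, ∀ x ∈ verSubN A CH ΛL n, ∀ y ∈ verSub A ΛL,
      verD S CH (verMul S CH (x ⊗ₜ[k] y)) =
        verMul S CH (verD S CH x ⊗ₜ[k] y) +
          ((-1 : k) ^ n) • verMul S CH (x ⊗ₜ[k] verD S CH y)) ∧
    -- generation in degree zero by `ver⁰ = A ⊗ k`
    (∀ W : Submodule k (A ⊗[k] ΩH),
      (∀ a : A, a ⊗ₜ[k] (1 : ΩH) ∈ W) →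
      (∀ x ∈ W, ∀ y ∈ W, verMul S CH (x ⊗ₜ[k] y) ∈ W) →
      (∀ x ∈ W, verD S CH x ∈ W) →
      verSub A ΛL ≤ W) := by
  have hL := hbicov.2.1
  exact ⟨fun x hx y hy => verMul_mem_verSub hL hx hy,
    fun x _ y _ z _ => verMul_assoc CH x y z,
    fun x _ => ⟨one_verMul CH x, verMul_one CH x⟩,
    fun n x hx => verD_mem_verSubN hL hx,
    fun x _ => verD_verD CH x,
    fun n x hx y _ => verD_verMul hx y,
    fun W hA hmul hd => verSub_le_of_closed hL hQPB.1.1 W hA hmul hd⟩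

end NCG
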